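/- Suppose τ_1 and τ_2 are differentiable at q = 1, and let γ'_−(1), γ'_+(1) denote the one-sided derivatives of the convex function γ at 1 (which exist). (1) If γ_1'(1) ≤ τ_1'(1)+τ_2'(1), then lim_{k→∞} γ_k'(1) = inf_{k∈ℕ} γ_k'(1) ≥ γ'_+(1) ≥ γ'_−(1). (2) If γ_1'(1) ≥ τ_1'(1)+τ_2'(1), then lim_{k→∞} γ_k'(1) = sup_{k∈ℕ} γ_k'(1) ≤ γ'_−(1) ≤ γ'_+(1). -/

import Mathlib

open MeasureTheory Filter Set

attribute [local instance] Classical.propDecidable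

noncomputable section

/-- Data of a box-like planar self-affine IFS: each map is `S i = T i ∘ L i + t i`, where
`T i` is the diagonal contraction `diag (c i, d i)` with `c i, d i ∈ (0,1)` and `L i` is a
linear isometry of the plane preserving `[-1,1]²`, i.e. one of the eight symmetries of the
square, encoded by whether it swaps the two axes (`swap`) and by a sign on each coordinate. -/
structure IFSData (ι : Type) where
  c : ι → ℝ
  d : ι → ℝ
  swap : ι → Bool
  sgn1 : ι → Bool
  sgn2 : ι → Bool
  t : ι → ℝ × ℝ

namespace IFSData

variable {ι : Type}

/-- The affine contraction `S i = T i ∘ L i + t i`. -/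
def S (B : IFSData ι) (i : ι) (x : ℝ × ℝ) : ℝ × ℝ :=
  ((if B.sgn1 i then 1 else -1) * (B.c i * (if B.swap i then x.2 else x.1)) + (B.t i).1,
   (if B.sgn2 i then 1 else -1) * (B.d i * (if B.swap i then x.1 else x.2)) + (B.t i).2)

/-- `(b(i), h(i))`: base and height of the rectangle `S_i([0,1]²)` for a finite word `i`. -/
def dims (B : IFSData ι) (l : List ι) : ℝ × ℝ :=
  l.foldr (fun i w =>
    (B.c i * (if B.swap i then w.2 else w.1), B.d i * (if B.swap i then w.1 else w.2))) (1, 1)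

/-- `α₁(i)`: the larger singular value of the linear part of `S_i`. -/
def alpha1 (B : IFSData ι) (l : List ι) : ℝ := max (B.dims l).1 (B.dims l).2

/-- `α₂(i)`: the smaller singular value of the linear part of `S_i`. -/
def alpha2 (B : IFSData ι) (l : List ι) : ℝ := min (B.dims l).1 (B.dims l).2

/-- Whether the composite map of the word maps horizontal lines to vertical lines. -/
def swapW (B : IFSData ι) (l : List ι) : Bool := l.foldr (fun i b => xor (B.swap i) b) false

/-- The composite map `S_{i₁} ∘ ⋯ ∘ S_{i_k}` of a word. -/
def Sw (B : IFSData ι) (l : List ι) : ℝ × ℝ → ℝ × ℝ := l.foldr (fun i f => B.S i ∘ f) id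

/-- The word `i` projects onto the first coordinate, i.e. `π_i = π₁`. -/
def usesPi1 (B : IFSData ι) (l : List ι) : Prop :=
  (B.swapW l = false ∧ (B.dims l).2 ≤ (B.dims l).1) ∨
    (B.swapW l = true ∧ (B.dims l).1 < (B.dims l).2)

/-- The projection `π_i` onto the direction of the longest side of `S_i([0,1]²)`. -/
def projW (B : IFSData ι) (l : List ι) : ℝ × ℝ → ℝ :=
  if B.usesPi1 l then Prod.fst else Prod.snd

/-- The rectangular open set condition. -/
def ROSC (B : IFSData ι) : Prop :=
  ∃ x₁ x₂ y₁ y₂ : ℝ, x₁ < x₂ ∧ y₁ < y₂ ∧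
    (∀ i, B.S i '' (Set.Ioo x₁ x₂ ×ˢ Set.Ioo y₁ y₂) ⊆ Set.Ioo x₁ x₂ ×ˢ Set.Ioo y₁ y₂) ∧
    Pairwise fun i j =>
      Disjoint (B.S i '' (Set.Ioo x₁ x₂ ×ˢ Set.Ioo y₁ y₂))
        (B.S j '' (Set.Ioo x₁ x₂ ×ˢ Set.Ioo y₁ y₂))

end IFSData

/-- `p(i)`: the probability of a finite word. -/
def wordProb {ι : Type} (p : ι → ℝ) (l : List ι) : ℝ := (l.map p).prod

/-- `τ_i(q)`: the value of the `L^q`-spectrum of the projection `π_i μ`. -/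
def tauW {ι : Type} (B : IFSData ι) (τ1 τ2 : ℝ → ℝ) (l : List ι) (q : ℝ) : ℝ :=
  if B.usesPi1 l then τ1 q else τ2 q

/-- The `q`-modified singular value function `ψ^{s,q}`. -/
def psiSV {ι : Type} (B : IFSData ι) (p : ι → ℝ) (τ1 τ2 : ℝ → ℝ) (s q : ℝ) (l : List ι) : ℝ :=
  wordProb p l ^ q * B.alpha1 l ^ tauW B τ1 τ2 l q * B.alpha2 l ^ (s - tauW B τ1 τ2 l q)

/-- `Ψ_k^{s,q} = ∑_{i ∈ I^k} ψ^{s,q}(i)`. -/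
def PsiSV {ι : Type} [Fintype ι] (B : IFSData ι) (p : ι → ℝ) (τ1 τ2 : ℝ → ℝ)
    (k : ℕ) (s q : ℝ) : ℝ :=
  ∑ f : Fin k → ι, psiSV B p τ1 τ2 s q (List.ofFn f)

/-- The lower `L^q`-spectrum of a measure. -/
def lowerLq {X : Type*} [MeasurableSpace X] [PseudoMetricSpace X] (ν : Measure X) (q : ℝ) : ℝ :=
  liminf (fun δ : ℝ =>
      Real.log (∫ x, (ν (Metric.ball x δ)).toReal ^ (q - 1) ∂ν) / (-Real.log δ))
    (nhdsWithin 0 (Set.Ioi 0))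

/-- The upper `L^q`-spectrum of a measure. -/
def upperLq {X : Type*} [MeasurableSpace X] [PseudoMetricSpace X] (ν : Measure X) (q : ℝ) : ℝ :=
  limsup (fun δ : ℝ =>
      Real.log (∫ x, (ν (Metric.ball x δ)).toReal ^ (q - 1) ∂ν) / (-Real.log δ))
    (nhdsWithin 0 (Set.Ioi 0))

/-- The `L^q`-spectrum of `ν` exists and equals `t`. -/
def IsLqSpec {X : Type*} [MeasurableSpace X] [PseudoMetricSpace X]
    (ν : Measure X) (q t : ℝ) : Prop :=
  lowerLq ν q = t ∧ upperLq ν q = t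

/-- `α_min = min_{i ∈ I} α₂(i)`. -/
def alphaMin {ι : Type} [Fintype ι] [Nonempty ι] (B : IFSData ι) : ℝ :=
  Finset.univ.inf' Finset.univ_nonempty fun i => min (B.c i) (B.d i)

/-- `α_max = max_{i ∈ I} α₁(i)`. -/
def alphaMax {ι : Type} [Fintype ι] [Nonempty ι] (B : IFSData ι) : ℝ :=
  Finset.univ.sup' Finset.univ_nonempty fun i => max (B.c i) (B.d i)

/-- `p_max = max_{i ∈ I} p_i`. -/
def pMax {ι : Type} [Fintype ι] [Nonempty ι] (p : ι → ℝ) : ℝ :=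
  Finset.univ.sup' Finset.univ_nonempty p

/-- The `δ`-stopping `I_δ`. -/
def stopping {ι : Type} (B : IFSData ι) (δ : ℝ) : Set (List ι) :=
  {l | l ≠ [] ∧ B.alpha2 l < δ ∧ δ ≤ B.alpha2 l.dropLast}

/-! ### Part 1: the `L^q` integrals on the line -/

def lqI (ν : Measure ℝ) (q δ : ℝ) : ℝ := ∫ x, (ν (Metric.ball x δ)).toReal ^ (q - 1) ∂ν

lemma meas_ball (ν : Measure ℝ) [IsProbabilityMeasure ν] (δ : ℝ) :
    Measurable fun x => ν (Metric.ball x δ) := by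
  have hs : MeasurableSet {z : ℝ × ℝ | dist z.2 z.1 < δ} :=
    measurableSet_lt (by fun_prop) (by fun_prop)
  exact measurable_measure_prodMk_left hs

lemma ball_pos_ae (ν : Measure ℝ) [IsProbabilityMeasure ν] {δ : ℝ} (hδ : 0 < δ) :
    ∀ᵐ x ∂ν, 0 < (ν (Metric.ball x δ)).toReal := by
  filter_upwards [Measure.support_mem_ae (μ := ν)] with x hx
  exact ENNReal.toReal_pos
    ((Measure.mem_support_iff_forall x).1 hx _ (Metric.ball_mem_nhds x hδ)).ne' (measure_ne_top _ _)

lemma ball_le_one (ν : Measure ℝ) [IsProbabilityMeasure ν] (x δ : ℝ) :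
    (ν (Metric.ball x δ)).toReal ≤ 1 := by
  have := prob_le_one (μ := ν) (s := Metric.ball x δ)
  exact ENNReal.toReal_le_of_le_ofReal zero_le_one (by simpa using this)

lemma inv_bound (ν : Measure ℝ) [IsProbabilityMeasure ν] {R : ℝ} (hR : 0 ≤ R)
    (hν : ν (Icc (-R) R)ᶜ = 0) {δ : ℝ} (hδ : 0 < δ) (hδ1 : δ < 1) :
    ∫⁻ x, (ν (Metric.ball x δ))⁻¹ ∂ν ≤ ENNReal.ofReal ((2 * R + 2) / δ) := by
  set Q : ℤ → Set ℝ := fun n => {x | ⌊x / δ⌋ = n} with hQ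
  have hQm : ∀ n, MeasurableSet (Q n) := by
    intro n
    have : Measurable fun x : ℝ => ⌊x / δ⌋ := by fun_prop
    exact this (measurableSet_singleton n)
  set s : Finset ℤ := Finset.Icc ⌊-R / δ⌋ ⌊R / δ⌋ with hs
  have hle : ∀ᵐ x ∂ν, (ν (Metric.ball x δ))⁻¹ ≤
      ∑ n ∈ s, (Q n).indicator (fun _ => (ν (Q n))⁻¹) x := by
    have h1 : ∀ᵐ x ∂ν, x ∈ Icc (-R) R := by
      rw [ae_iff]; exact hν
    filter_upwards [h1] with x hx
    have hn : ⌊x / δ⌋ ∈ s := by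
      rw [hs, Finset.mem_Icc]
      exact ⟨Int.floor_mono (by gcongr; exact hx.1), Int.floor_mono (by gcongr; exact hx.2)⟩
    have h2 : (ν (Metric.ball x δ))⁻¹ ≤
        (Q ⌊x / δ⌋).indicator (fun _ => (ν (Q ⌊x / δ⌋))⁻¹) x := by
      rw [indicator_of_mem (by simp [hQ])]
      refine ENNReal.inv_le_inv.2 (measure_mono ?_)
      intro y hy
      simp only [hQ, mem_ofPred_eq] at hy
      have hy1 := Int.abs_sub_lt_one_of_floor_eq_floor hy
      rw [Metric.mem_ball, Real.dist_eq]
      have : y - x = (y / δ - x / δ) * δ := by field_simp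
      rw [this, abs_mul, abs_of_pos hδ]
      nlinarith
    exact h2.trans (Finset.single_le_sum
      (f := fun n => (Q n).indicator (fun _ => (ν (Q n))⁻¹) x) (fun _ _ => zero_le) hn)
  calc ∫⁻ x, (ν (Metric.ball x δ))⁻¹ ∂ν
      ≤ ∫⁻ x, ∑ n ∈ s, (Q n).indicator (fun _ => (ν (Q n))⁻¹) x ∂ν := lintegral_mono_ae hle
    _ = ∑ n ∈ s, (ν (Q n))⁻¹ * ν (Q n) := by
        rw [lintegral_finsetSum _ (fun n _ => measurable_const.indicator (hQm n))]
        refine Finset.sum_congr rfl fun n _ => ?_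
        rw [lintegral_indicator_const (hQm n)]
    _ ≤ ∑ n ∈ s, 1 := Finset.sum_le_sum fun n _ => ENNReal.inv_mul_le_one _
    _ = ENNReal.ofReal (s.card : ℝ) := by simp
    _ ≤ ENNReal.ofReal ((2 * R + 2) / δ) := by
        apply ENNReal.ofReal_le_ofReal
        rw [hs, Int.card_Icc]
        have h0 : ⌊-R / δ⌋ ≤ ⌊R / δ⌋ := Int.floor_mono (by gcongr; linarith)
        have h1 : ((⌊R / δ⌋ + 1 - ⌊-R / δ⌋).toNat : ℝ) = ((⌊R / δ⌋ + 1 - ⌊-R / δ⌋ : ℤ) : ℝ) := by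
          have : (((⌊R / δ⌋ + 1 - ⌊-R / δ⌋).toNat : ℤ) : ℝ) =
            ((⌊R / δ⌋ + 1 - ⌊-R / δ⌋ : ℤ) : ℝ) := by rw [Int.toNat_of_nonneg (by linarith)]
          exact_mod_cast this
        rw [h1]; push_cast
        have h2 := Int.floor_le (R / δ)
        have h3 := Int.lt_floor_add_one (-R / δ)
        have h4 : (2 * R + 2) / δ = R / δ - (-R / δ) + 2 / δ := by ring
        have h5 : 2 ≤ 2 / δ := by rw [le_div_iff₀ hδ]; linarith
        linarith

lemma integrable_inv (ν : Measure ℝ) [IsProbabilityMeasure ν] {R : ℝ} (hR : 0 ≤ R)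
    (hν : ν (Icc (-R) R)ᶜ = 0) {δ : ℝ} (hδ : 0 < δ) (hδ1 : δ < 1) :
    Integrable (fun x => ((ν (Metric.ball x δ))⁻¹).toReal) ν :=
  integrable_toReal_of_lintegral_ne_top (meas_ball ν δ).inv.aemeasurable
    ((inv_bound ν hR hν hδ hδ1).trans_lt ENNReal.ofReal_lt_top).ne

lemma integrable_lq (ν : Measure ℝ) [IsProbabilityMeasure ν] {R : ℝ} (hR : 0 ≤ R)
    (hν : ν (Icc (-R) R)ᶜ = 0) {δ : ℝ} (hδ : 0 < δ) (hδ1 : δ < 1) {q : ℝ} (hq : 0 ≤ q) :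
    Integrable (fun x => (ν (Metric.ball x δ)).toReal ^ (q - 1)) ν := by
  refine (integrable_inv ν hR hν hδ hδ1).mono'
    ((meas_ball ν δ).ennreal_toReal.pow_const _).aestronglyMeasurable ?_
  filter_upwards [ball_pos_ae ν hδ] with x hx
  rw [Real.norm_of_nonneg (by positivity), ENNReal.toReal_inv, ← Real.rpow_neg_one]
  exact Real.rpow_le_rpow_of_exponent_ge hx (ball_le_one ν x δ) (by linarith)

lemma lqI_pos (ν : Measure ℝ) [IsProbabilityMeasure ν] {R : ℝ} (hR : 0 ≤ R)
    (hν : ν (Icc (-R) R)ᶜ = 0) {δ : ℝ} (hδ : 0 < δ) (hδ1 : δ < 1) {q : ℝ} (hq : 0 ≤ q) :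
    0 < lqI ν q δ := by
  have h1 := integrable_lq ν hR hν hδ hδ1 hq
  have h0 : 0 ≤ lqI ν q δ := integral_nonneg fun x => by positivity
  refine lt_of_le_of_ne h0 fun h => ?_
  have h2 := (integral_eq_zero_iff_of_nonneg (fun x => by positivity) h1).1 h.symm
  have h3 : ∀ᵐ x ∂ν, False := by
    filter_upwards [h2, ball_pos_ae ν hδ] with x hx hx'
    have := Real.rpow_pos_of_pos hx' (q - 1)
    simp at hx
    linarith
  rw [Filter.eventually_false_iff_eq_bot, ae_eq_bot] at h3
  exact IsProbabilityMeasure.ne_zero ν h3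

lemma lqI_one (ν : Measure ℝ) [IsProbabilityMeasure ν] (δ : ℝ) : lqI ν 1 δ = 1 := by
  simp [lqI]

lemma lqI_convex (ν : Measure ℝ) [IsProbabilityMeasure ν] {R : ℝ} (hR : 0 ≤ R)
    (hν : ν (Icc (-R) R)ᶜ = 0) {δ : ℝ} (hδ : 0 < δ) (hδ1 : δ < 1) {x y a b : ℝ}
    (hx : 0 ≤ x) (hy : 0 ≤ y) (ha : 0 ≤ a) (hb : 0 ≤ b) (hab : a + b = 1) :
    Real.log (lqI ν (a * x + b * y) δ) ≤ a * Real.log (lqI ν x δ) + b * Real.log (lqI ν y δ) := by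
  set A := lqI ν x δ with hA
  set C := lqI ν y δ with hC
  have hA0 : 0 < A := lqI_pos ν hR hν hδ hδ1 hx
  have hC0 : 0 < C := lqI_pos ν hR hν hδ hδ1 hy
  have hxi := integrable_lq ν hR hν hδ hδ1 hx
  have hyi := integrable_lq ν hR hν hδ hδ1 hy
  have hm : 0 ≤ a * x + b * y := by positivity
  have hmi := integrable_lq ν hR hν hδ hδ1 hm
  have key : lqI ν (a * x + b * y) δ ≤ A ^ a * C ^ b := by
    have h1 : lqI ν (a * x + b * y) δ ≤
        ∫ z, (A ^ a * C ^ b) * (a * ((ν (Metric.ball z δ)).toReal ^ (x - 1) / A) +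
          b * ((ν (Metric.ball z δ)).toReal ^ (y - 1) / C)) ∂ν := by
      refine integral_mono_ae hmi ?_ ?_
      · exact (((hxi.div_const A).const_mul a).add ((hyi.div_const C).const_mul b)).const_mul _
      · filter_upwards [ball_pos_ae ν hδ] with z hz
        have := Real.geom_mean_le_arith_mean2_weighted ha hb
          (p₁ := (ν (Metric.ball z δ)).toReal ^ (x - 1) / A)
          (p₂ := (ν (Metric.ball z δ)).toReal ^ (y - 1) / C) (by positivity) (by positivity) hab
        refine le_trans (le_of_eq ?_) (mul_le_mul_of_nonneg_left this (by positivity))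
        rw [Real.div_rpow (by positivity) hA0.le, Real.div_rpow (by positivity) hC0.le,
          ← Real.rpow_mul hz.le, ← Real.rpow_mul hz.le]
        have e : a * x + b * y - 1 = (x - 1) * a + (y - 1) * b := by linear_combination hab
        rw [e, Real.rpow_add hz]
        have := (Real.rpow_pos_of_pos hA0 a).ne'
        have := (Real.rpow_pos_of_pos hC0 b).ne'
        field_simp
    refine h1.trans (le_of_eq ?_)
    rw [integral_const_mul, integral_add ((hxi.div_const A).const_mul a)
      ((hyi.div_const C).const_mul b), integral_const_mul, integral_const_mul, integral_div,
      integral_div]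
    change A ^ a * C ^ b * (a * (A / A) + b * (C / C)) = _
    rw [div_self hA0.ne', div_self hC0.ne', mul_one, mul_one, hab, mul_one]
  have := Real.log_le_log (lqI_pos ν hR hν hδ hδ1 hm) key
  rwa [Real.log_mul (by positivity) (by positivity), Real.log_rpow hA0, Real.log_rpow hC0] at this

lemma lqI_zero_le (ν : Measure ℝ) [IsProbabilityMeasure ν] {R : ℝ} (hR : 0 ≤ R)
    (hν : ν (Icc (-R) R)ᶜ = 0) {δ : ℝ} (hδ : 0 < δ) (hδ1 : δ < 1) :
    lqI ν 0 δ ≤ (2 * R + 2) / δ := by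
  have : lqI ν 0 δ = (∫⁻ x, (ν (Metric.ball x δ))⁻¹ ∂ν).toReal := by
    rw [← integral_toReal (f := fun x => (ν (Metric.ball x δ))⁻¹) (meas_ball ν δ).inv.aemeasurable]
    · refine integral_congr_ae (ae_of_all _ fun x => ?_)
      dsimp only
      rw [zero_sub, Real.rpow_neg_one, ENNReal.toReal_inv]
    · filter_upwards [ball_pos_ae ν hδ] with x hx
      exact ENNReal.inv_lt_top.2 (ENNReal.toReal_pos_iff.1 hx).1
  rw [this]
  exact ENNReal.toReal_le_of_le_ofReal (by positivity) (inv_bound ν hR hν hδ hδ1)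

lemma lqI_anti (ν : Measure ℝ) [IsProbabilityMeasure ν] {R : ℝ} (hR : 0 ≤ R)
    (hν : ν (Icc (-R) R)ᶜ = 0) {δ : ℝ} (hδ : 0 < δ) (hδ1 : δ < 1) {x y : ℝ}
    (hx : 0 ≤ x) (hxy : x ≤ y) : lqI ν y δ ≤ lqI ν x δ := by
  refine integral_mono_ae (integrable_lq ν hR hν hδ hδ1 (hx.trans hxy))
    (integrable_lq ν hR hν hδ hδ1 hx) ?_
  filter_upwards [ball_pos_ae ν hδ] with z hz
  exact Real.rpow_le_rpow_of_exponent_ge hz (ball_le_one ν z δ) (by linarith)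

lemma lq_abs_bound (ν : Measure ℝ) [IsProbabilityMeasure ν] {R : ℝ} (hR : 0 ≤ R)
    (hν : ν (Icc (-R) R)ᶜ = 0) {δ : ℝ} (hδ : 0 < δ) (hδ1 : δ < 1) {q : ℝ} (hq : 0 ≤ q) :
    |Real.log (lqI ν q δ)| ≤ (1 + q) * Real.log (lqI ν 0 δ) := by
  have h1 : 1 ≤ lqI ν 0 δ := by
    rw [← lqI_one ν δ]; exact lqI_anti ν hR hν hδ hδ1 le_rfl zero_le_one
  have hL : 0 ≤ Real.log (lqI ν 0 δ) := Real.log_nonneg h1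
  have h2 : Real.log (lqI ν q δ) ≤ Real.log (lqI ν 0 δ) :=
    Real.log_le_log (lqI_pos ν hR hν hδ hδ1 hq) (lqI_anti ν hR hν hδ hδ1 le_rfl hq)
  rw [abs_le]
  refine ⟨?_, by nlinarith⟩
  rcases le_total q 1 with h | h
  · have : 1 ≤ lqI ν q δ := by
      rw [← lqI_one ν δ]; exact lqI_anti ν hR hν hδ hδ1 hq h
    have := Real.log_nonneg this
    nlinarith
  · have hq0 : 0 < q := by linarith
    have h3 := lqI_convex ν hR hν hδ hδ1 (x := q) (y := 0) (a := 1 / q) (b := 1 - 1 / q) hq le_rfl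
      (by positivity) (by rw [sub_nonneg, div_le_one hq0]; exact h) (by ring)
    have e : 1 / q * q + (1 - 1 / q) * 0 = 1 := by field_simp; ring
    rw [e, lqI_one, Real.log_one] at h3
    have h4 : 0 ≤ Real.log (lqI ν q δ) + (q - 1) * Real.log (lqI ν 0 δ) := by
      have := mul_nonneg hq0.le h3
      have e2 : q * (1 / q * Real.log (lqI ν q δ) + (1 - 1 / q) * Real.log (lqI ν 0 δ)) =
        Real.log (lqI ν q δ) + (q - 1) * Real.log (lqI ν 0 δ) := by field_simp
      linarith
    nlinarith

lemma ev_small : ∀ᶠ δ : ℝ in nhdsWithin 0 (Ioi 0), 0 < δ ∧ δ < 1 / 2 := by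
  have := Ioo_mem_nhdsGT (show (0 : ℝ) < 1 / 2 by norm_num)
  filter_upwards [this] with δ h using h

lemma lq_tendsto (ν : Measure ℝ) [IsProbabilityMeasure ν] {R : ℝ} (hR : 0 ≤ R)
    (hν : ν (Icc (-R) R)ᶜ = 0) {q t : ℝ} (hq : 0 ≤ q) (h : IsLqSpec ν q t) :
    Tendsto (fun δ : ℝ => Real.log (lqI ν q δ) / (-Real.log δ)) (nhdsWithin 0 (Ioi 0))
      (nhds t) := by
  have hb : ∀ᶠ δ : ℝ in nhdsWithin 0 (Ioi 0),
      |Real.log (lqI ν q δ) / (-Real.log δ)| ≤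
        (1 + q) * (1 + Real.log (2 * R + 2) / Real.log 2) := by
    filter_upwards [ev_small] with δ hδ
    obtain ⟨h0, h2⟩ := hδ
    have h1 : δ < 1 := by linarith
    have hl : Real.log 2 ≤ -Real.log δ := by
      rw [← Real.log_inv]
      apply Real.log_le_log (by norm_num)
      rw [le_inv_comm₀ (by norm_num) h0]; linarith
    have hl2 : 0 < Real.log 2 := Real.log_pos (by norm_num)
    have hl3 : 0 < -Real.log δ := by linarith
    rw [abs_div, abs_of_pos hl3, div_le_iff₀ hl3]
    refine (lq_abs_bound ν hR hν h0 h1 hq).trans ?_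
    rw [mul_assoc]
    refine mul_le_mul_of_nonneg_left ?_ (by linarith)
    have h5 := Real.log_le_log (lqI_pos ν hR hν h0 h1 le_rfl) (lqI_zero_le ν hR hν h0 h1)
    rw [Real.log_div (by positivity) h0.ne'] at h5
    have h6 : 0 ≤ Real.log (2 * R + 2) := Real.log_nonneg (by linarith)
    have h7 : Real.log (2 * R + 2) ≤ Real.log (2 * R + 2) / Real.log 2 * (-Real.log δ) := by
      rw [div_mul_eq_mul_div, le_div_iff₀ hl2]
      nlinarith
    linarith
  refine tendsto_of_liminf_eq_limsup h.1 h.2 ?_ ?_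
  · exact isBoundedUnder_of_eventually_le (hb.mono fun δ hδ => (abs_le.1 hδ).2)
  · exact isBoundedUnder_of_eventually_ge (hb.mono fun δ hδ => (abs_le.1 hδ).1)

lemma tau_convex (ν : Measure ℝ) [IsProbabilityMeasure ν] {R : ℝ} (hR : 0 ≤ R)
    (hν : ν (Icc (-R) R)ᶜ = 0) {τ : ℝ → ℝ} (h : ∀ q : ℝ, 0 ≤ q → IsLqSpec ν q (τ q)) :
    ConvexOn ℝ (Ici 0) τ := by
  refine ⟨convex_Ici 0, fun x hx y hy a b ha hb hab => ?_⟩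
  simp only [mem_Ici] at hx hy
  simp only [smul_eq_mul]
  have hm : 0 ≤ a * x + b * y := by positivity
  refine le_of_tendsto_of_tendsto (lq_tendsto ν hR hν hm (h _ hm))
    (((lq_tendsto ν hR hν hx (h _ hx)).const_mul a).add
      ((lq_tendsto ν hR hν hy (h _ hy)).const_mul b)) ?_
  filter_upwards [ev_small] with δ hδ
  obtain ⟨h0, h2⟩ := hδ
  have h1 : δ < 1 := by linarith
  have hl : 0 < -Real.log δ := by have := Real.log_neg h0 h1; linarith
  rw [← mul_div_assoc, ← mul_div_assoc, ← add_div]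
  exact div_le_div_of_nonneg_right (lqI_convex ν hR hν h0 h1 hx hy ha hb hab) hl.le

lemma tau_one (ν : Measure ℝ) [IsProbabilityMeasure ν] {R : ℝ} (hR : 0 ≤ R)
    (hν : ν (Icc (-R) R)ᶜ = 0) {t : ℝ} (h : IsLqSpec ν 1 t) : t = 0 := by
  have h1 := lq_tendsto ν hR hν zero_le_one h
  simp only [lqI_one, Real.log_one, zero_div] at h1
  exact tendsto_nhds_unique h1 tendsto_const_nhds

lemma tau_compare (ν1 ν2 : Measure ℝ) [IsProbabilityMeasure ν1] [IsProbabilityMeasure ν2]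
    {R : ℝ} (hR : 0 ≤ R) (hν1 : ν1 (Icc (-R) R)ᶜ = 0) (hν2 : ν2 (Icc (-R) R)ᶜ = 0)
    {p : ℝ} (hp : 0 < p) {A : ℝ → ℝ} (hAm : Measurable A) (hA : ∀ x y, dist (A x) (A y) ≤ dist x y)
    (hle : ENNReal.ofReal p • Measure.map A ν2 ≤ ν1) {q t1 t2 : ℝ} (hq : 1 ≤ q)
    (h1 : IsLqSpec ν1 q t1) (h2 : IsLqSpec ν2 q t2) : t2 ≤ t1 := by
  have hq0 : 0 ≤ q := by linarith
  have key : ∀ δ : ℝ, 0 < δ → δ < 1 → p ^ q * lqI ν2 q δ ≤ lqI ν1 q δ := by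
    intro δ h0 h1
    have hf1 := integrable_lq ν1 hR hν1 h0 h1 hq0
    have hf2 := integrable_lq ν2 hR hν2 h0 h1 hq0
    have hfm : Measurable (fun x => (ν1 (Metric.ball x δ)).toReal ^ (q - 1)) :=
      (meas_ball ν1 δ).ennreal_toReal.pow_const _
    have hf3 := hf1.mono_measure hle
    have hf4 : Integrable (fun x => (ν1 (Metric.ball (A x) δ)).toReal ^ (q - 1)) ν2 := by
      have := (integrable_smul_measure (by simpa using hp) ENNReal.ofReal_ne_top).1 hf3
      exact this.comp_measurable hAm
    calc p ^ q * lqI ν2 q δ = p * ∫ x, p ^ (q - 1) * (ν2 (Metric.ball x δ)).toReal ^ (q - 1) ∂ν2 := by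
          rw [integral_const_mul, lqI, ← mul_assoc]
          congr 1
          nth_rewrite 2 [← Real.rpow_one p]
          rw [← Real.rpow_add hp]; ring_nf
      _ ≤ p * ∫ x, (ν1 (Metric.ball (A x) δ)).toReal ^ (q - 1) ∂ν2 := by
          refine mul_le_mul_of_nonneg_left (integral_mono (hf2.const_mul _) hf4 fun x => ?_) hp.le
          dsimp only
          rw [← Real.mul_rpow hp.le ENNReal.toReal_nonneg]
          refine Real.rpow_le_rpow (by positivity) ?_ (by linarith)
          have e1 : ENNReal.ofReal p * ν2 (Metric.ball x δ) ≤ ν1 (Metric.ball (A x) δ) := by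
            refine le_trans ?_ (hle _)
            rw [Measure.smul_apply, smul_eq_mul, Measure.map_apply hAm measurableSet_ball]
            gcongr
            intro y hy
            exact lt_of_le_of_lt (hA y x) hy
          have := ENNReal.toReal_mono (measure_ne_top _ _) e1
          rwa [ENNReal.toReal_mul, ENNReal.toReal_ofReal hp.le] at this
      _ = ∫ x, (ν1 (Metric.ball x δ)).toReal ^ (q - 1) ∂(ENNReal.ofReal p • Measure.map A ν2) := by
          rw [integral_smul_measure, ENNReal.toReal_ofReal hp.le, smul_eq_mul,
            integral_map hAm.aemeasurable hfm.aestronglyMeasurable]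
      _ ≤ lqI ν1 q δ := integral_mono_measure hle (ae_of_all _ fun x => by positivity) hf1
  have hz : Tendsto (fun δ : ℝ => Real.log (p ^ q) / (-Real.log δ)) (nhdsWithin 0 (Ioi 0))
      (nhds 0) :=
    Tendsto.const_div_atTop (tendsto_neg_atBot_atTop.comp Real.tendsto_log_nhdsGT_zero) _
  have := le_of_tendsto_of_tendsto (hz.add (lq_tendsto ν2 hR hν2 hq0 h2))
    (lq_tendsto ν1 hR hν1 hq0 h1) ?_
  · simpa using this
  filter_upwards [ev_small] with δ hδ
  obtain ⟨h0, h2⟩ := hδ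
  have h1 : δ < 1 := by linarith
  have hl : 0 < -Real.log δ := by have := Real.log_neg h0 h1; linarith
  rw [← add_div]
  refine div_le_div_of_nonneg_right ?_ hl.le
  have hpos := lqI_pos ν2 hR hν2 h0 h1 hq0
  rw [← Real.log_mul (by positivity) hpos.ne']
  exact Real.log_le_log (by positivity) (key δ h0 h1)

/-! ### Part 2: words -/

section words
variable {ι : Type}

lemma swapW_append (B : IFSData ι) (l m : List ι) :
    B.swapW (l ++ m) = xor (B.swapW l) (B.swapW m) := by
  induction l with
  | nil => simp [IFSData.swapW]
  | cons i l ih =>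
    have : ∀ l : List ι, B.swapW (i :: l) = xor (B.swap i) (B.swapW l) := fun _ => rfl
    rw [List.cons_append, this, this, ih, Bool.xor_assoc]

lemma dims_cons (B : IFSData ι) (i : ι) (l : List ι) :
    B.dims (i :: l) = (B.c i * (if B.swap i then (B.dims l).2 else (B.dims l).1),
      B.d i * (if B.swap i then (B.dims l).1 else (B.dims l).2)) := rfl

lemma dims_append (B : IFSData ι) (l m : List ι) :
    B.dims (l ++ m) =
      ((B.dims l).1 * (if B.swapW l then (B.dims m).2 else (B.dims m).1),
       (B.dims l).2 * (if B.swapW l then (B.dims m).1 else (B.dims m).2)) := by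
  induction l with
  | nil => simp [IFSData.swapW, IFSData.dims]
  | cons i l ih =>
    have : B.swapW (i :: l) = xor (B.swap i) (B.swapW l) := rfl
    rw [List.cons_append, dims_cons, ih, dims_cons, this]
    cases B.swap i <;> cases B.swapW l <;> simp [mul_assoc]

lemma dims_pos (B : IFSData ι) (hc : ∀ i, 0 < B.c i) (hd : ∀ i, 0 < B.d i) (l : List ι) :
    0 < (B.dims l).1 ∧ 0 < (B.dims l).2 := by
  induction l with
  | nil => simp [IFSData.dims]
  | cons i l ih =>
    rw [dims_cons]
    have := hc i
    have := hd i
    obtain ⟨h1, h2⟩ := ih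
    cases B.swap i <;> simp <;> constructor <;> positivity

lemma wordProb_append (p : ι → ℝ) (l m : List ι) :
    wordProb p (l ++ m) = wordProb p l * wordProb p m := by
  simp [wordProb]

lemma wordProb_pos (p : ι → ℝ) (hp : ∀ i, 0 < p i) (l : List ι) : 0 < wordProb p l := by
  refine List.prod_pos ?_
  intro a ha
  obtain ⟨i, -, rfl⟩ := List.mem_map.1 ha
  exact hp i

/-- the length of the image of the horizontal side -/
def sx (B : IFSData ι) (l : List ι) : ℝ := if B.swapW l then (B.dims l).2 else (B.dims l).1
/-- the length of the image of the vertical side -/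
def sy (B : IFSData ι) (l : List ι) : ℝ := if B.swapW l then (B.dims l).1 else (B.dims l).2

lemma sxy_append_false (B : IFSData ι) (l m : List ι) (h : B.swapW m = false) :
    sx B (l ++ m) = sx B l * sx B m ∧ sy B (l ++ m) = sy B l * sy B m := by
  simp only [sx, sy, swapW_append, dims_append, h]
  cases B.swapW l <;> simp

lemma sxy_append_true (B : IFSData ι) (l m : List ι) (h : B.swapW m = true) :
    sx B (l ++ m) = sy B l * sx B m ∧ sy B (l ++ m) = sx B l * sy B m := by
  simp only [sx, sy, swapW_append, dims_append, h]
  cases B.swapW l <;> simp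

lemma sxy_pos (B : IFSData ι) (hc : ∀ i, 0 < B.c i) (hd : ∀ i, 0 < B.d i) (l : List ι) :
    0 < sx B l ∧ 0 < sy B l := by
  obtain ⟨h1, h2⟩ := dims_pos B hc hd l
  unfold sx sy
  cases B.swapW l <;> simp [h1, h2]

lemma exists_swap_letter (B : IFSData ι) (l : List ι) (h : B.swapW l = true) : ∃ i, B.swap i = true := by
  by_contra hn
  push Not at hn
  have : ∀ l : List ι, B.swapW l = false := by
    intro l
    induction l with
    | nil => rfl
    | cons i l ih =>
      have e : B.swapW (i :: l) = xor (B.swap i) (B.swapW l) := rfl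
      rw [e, ih]
      simpa using hn i
  simp [this] at h

/-- `log (α₁/α₂)`. -/
def lr (B : IFSData ι) (l : List ι) : ℝ := Real.log (B.alpha1 l) - Real.log (B.alpha2 l)
/-- `log α₂`. -/
def lm (B : IFSData ι) (l : List ι) : ℝ := Real.log (B.alpha2 l)

lemma alpha_cases (B : IFSData ι) (l : List ι) :
    (B.usesPi1 l ∧ B.alpha1 l = sx B l ∧ B.alpha2 l = sy B l ∧ sy B l ≤ sx B l) ∨
    (¬ B.usesPi1 l ∧ B.alpha1 l = sy B l ∧ B.alpha2 l = sx B l ∧ sx B l ≤ sy B l) := by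
  unfold IFSData.usesPi1 IFSData.alpha1 IFSData.alpha2 sx sy
  cases B.swapW l
  · rcases le_or_gt (B.dims l).2 (B.dims l).1 with h | h
    · left; simp [h]
    · right; simp [h, h.le]
  · rcases le_or_gt (B.dims l).2 (B.dims l).1 with h | h
    · right; simp [h]
    · left; simp [h, h.le]

lemma alpha_pos (B : IFSData ι) (hc : ∀ i, 0 < B.c i) (hd : ∀ i, 0 < B.d i) (l : List ι) :
    0 < B.alpha1 l ∧ 0 < B.alpha2 l := by
  obtain ⟨h1, h2⟩ := dims_pos B hc hd l
  exact ⟨lt_max_of_lt_left h1, lt_min h1 h2⟩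

lemma lr_nonneg (B : IFSData ι) (hc : ∀ i, 0 < B.c i) (hd : ∀ i, 0 < B.d i) (l : List ι) :
    0 ≤ lr B l := by
  obtain ⟨h1, h2⟩ := alpha_pos B hc hd l
  exact sub_nonneg.2 (Real.log_le_log h2 min_le_max)

lemma log_bounds [Finite ι] (B : IFSData ι) (hc : ∀ i, B.c i ∈ Ioo (0 : ℝ) 1)
    (hd : ∀ i, B.d i ∈ Ioo (0 : ℝ) 1) :
    ∃ a C : ℝ, 0 < a ∧ 0 < C ∧ ∀ l : List ι, lm B l ≤ -(a * l.length) ∧ lr B l ≤ C * l.length := by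
  have hlc : ∀ i, Real.log (B.c i) < 0 := fun i => Real.log_neg (hc i).1 (hc i).2
  have hld : ∀ i, Real.log (B.d i) < 0 := fun i => Real.log_neg (hd i).1 (hd i).2
  obtain ⟨a, ha, ha'⟩ : ∃ a : ℝ, 0 < a ∧ ∀ i, Real.log (B.c i) ≤ -a ∧ Real.log (B.d i) ≤ -a := by
    cases isEmpty_or_nonempty ι
    · exact ⟨1, one_pos, fun i => isEmptyElim i⟩
    · obtain ⟨i, hi⟩ := Finite.exists_max fun i => max (Real.log (B.c i)) (Real.log (B.d i))
      refine ⟨-(max (Real.log (B.c i)) (Real.log (B.d i))), ?_, fun j => ?_⟩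
      · rw [neg_pos]; exact max_lt (hlc i) (hld i)
      · have := hi j
        rw [neg_neg]
        exact ⟨(le_max_left _ _).trans this, (le_max_right _ _).trans this⟩
  obtain ⟨C, hC, hC'⟩ : ∃ C : ℝ, 0 < C ∧ ∀ i, -C ≤ Real.log (B.c i) ∧ -C ≤ Real.log (B.d i) := by
    cases isEmpty_or_nonempty ι
    · exact ⟨1, one_pos, fun i => isEmptyElim i⟩
    · obtain ⟨i, hi⟩ := Finite.exists_min fun i => min (Real.log (B.c i)) (Real.log (B.d i))
      refine ⟨-(min (Real.log (B.c i)) (Real.log (B.d i))), ?_, fun j => ?_⟩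
      · rw [neg_pos]; exact min_lt_of_left_lt (hlc i)
      · have := hi j
        rw [neg_neg]
        exact ⟨this.trans (min_le_left _ _), this.trans (min_le_right _ _)⟩
  have hc0 := fun i => (hc i).1
  have hd0 := fun i => (hd i).1
  have main : ∀ l : List ι, (-(C * l.length) ≤ Real.log (B.dims l).1 ∧
      Real.log (B.dims l).1 ≤ -(a * l.length)) ∧ (-(C * l.length) ≤ Real.log (B.dims l).2 ∧
      Real.log (B.dims l).2 ≤ -(a * l.length)) := by
    intro l
    induction l with
    | nil => simp [IFSData.dims]
    | cons i l ih =>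
      obtain ⟨h1, h2⟩ := dims_pos B hc0 hd0 l
      obtain ⟨⟨k1, k2⟩, k3, k4⟩ := ih
      obtain ⟨a1, a2⟩ := ha' i
      obtain ⟨b1, b2⟩ := hC' i
      rw [dims_cons]
      push_cast [List.length_cons]
      cases B.swap i
      · simp only [Bool.false_eq_true, if_false]
        rw [Real.log_mul (hc0 i).ne' h1.ne', Real.log_mul (hd0 i).ne' h2.ne']
        refine ⟨⟨?_, ?_⟩, ?_, ?_⟩ <;> linarith
      · simp only [if_true]
        rw [Real.log_mul (hc0 i).ne' h2.ne', Real.log_mul (hd0 i).ne' h1.ne']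
        refine ⟨⟨?_, ?_⟩, ?_, ?_⟩ <;> linarith
  refine ⟨a, C, ha, hC, fun l => ?_⟩
  obtain ⟨⟨k1, k2⟩, k3, k4⟩ := main l
  have hal : 0 ≤ a * l.length := by positivity
  unfold lr lm IFSData.alpha1 IFSData.alpha2
  rcases le_total (B.dims l).1 (B.dims l).2 with h | h
  · rw [min_eq_left h, max_eq_right h]; exact ⟨k2, by linarith⟩
  · rw [min_eq_right h, max_eq_left h]; exact ⟨k4, by linarith⟩

/-- The derivative of `log ψ` along the direction `(g, 1)` at `(0,1)`. -/
def th (B : IFSData ι) (p : ι → ℝ) (D1 D2 g : ℝ) (l : List ι) : ℝ :=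
  (Real.log (wordProb p l) + (if B.usesPi1 l then D1 else D2) * lr B l) + g * lm B l

lemma th_max (B : IFSData ι) (hc : ∀ i, 0 < B.c i) (hd : ∀ i, 0 < B.d i) (p : ι → ℝ)
    {D1 D2 g : ℝ} (hg : g ≤ D1 + D2) (l : List ι) :
    th B p D1 D2 g l = Real.log (wordProb p l) +
      max (D1 * Real.log (sx B l) + (g - D1) * Real.log (sy B l))
        (D2 * Real.log (sy B l) + (g - D2) * Real.log (sx B l)) := by
  obtain ⟨h1, h2⟩ := sxy_pos B hc hd l
  unfold th lr lm
  rcases alpha_cases B l with ⟨u, e1, e2, h⟩ | ⟨u, e1, e2, h⟩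
  · have := Real.log_le_log h2 h
    rw [max_eq_left (by nlinarith), if_pos u, e1, e2]; ring
  · have := Real.log_le_log h1 h
    rw [max_eq_right (by nlinarith), if_neg u, e1, e2]; ring

lemma th_min (B : IFSData ι) (hc : ∀ i, 0 < B.c i) (hd : ∀ i, 0 < B.d i) (p : ι → ℝ)
    {D1 D2 g : ℝ} (hg : D1 + D2 ≤ g) (l : List ι) :
    th B p D1 D2 g l = Real.log (wordProb p l) +
      min (D1 * Real.log (sx B l) + (g - D1) * Real.log (sy B l))
        (D2 * Real.log (sy B l) + (g - D2) * Real.log (sx B l)) := by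
  obtain ⟨h1, h2⟩ := sxy_pos B hc hd l
  unfold th lr lm
  rcases alpha_cases B l with ⟨u, e1, e2, h⟩ | ⟨u, e1, e2, h⟩
  · have := Real.log_le_log h2 h
    rw [min_eq_left (by nlinarith), if_pos u, e1, e2]; ring
  · have := Real.log_le_log h1 h
    rw [min_eq_right (by nlinarith), if_neg u, e1, e2]; ring

lemma log_sxy (B : IFSData ι) (hc : ∀ i, 0 < B.c i) (hd : ∀ i, 0 < B.d i) (l m : List ι) :
    (B.swapW m = false ∧ Real.log (sx B (l ++ m)) = Real.log (sx B l) + Real.log (sx B m) ∧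
      Real.log (sy B (l ++ m)) = Real.log (sy B l) + Real.log (sy B m)) ∨
    (B.swapW m = true ∧ Real.log (sx B (l ++ m)) = Real.log (sy B l) + Real.log (sx B m) ∧
      Real.log (sy B (l ++ m)) = Real.log (sx B l) + Real.log (sy B m)) := by
  obtain ⟨h1, h2⟩ := sxy_pos B hc hd l
  obtain ⟨h3, h4⟩ := sxy_pos B hc hd m
  cases h : B.swapW m
  · left
    obtain ⟨e1, e2⟩ := sxy_append_false B l m h
    rw [e1, e2, Real.log_mul h1.ne' h3.ne', Real.log_mul h2.ne' h4.ne']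
    simp
  · right
    obtain ⟨e1, e2⟩ := sxy_append_true B l m h
    rw [e1, e2, Real.log_mul h2.ne' h3.ne', Real.log_mul h1.ne' h4.ne']
    simp

lemma th_sub (B : IFSData ι) (hc : ∀ i, 0 < B.c i) (hd : ∀ i, 0 < B.d i) (p : ι → ℝ)
    (hp : ∀ i, 0 < p i) {D1 D2 g : ℝ} (hD : ∀ i, B.swap i = true → D1 = D2)
    (hg : g ≤ D1 + D2) (l m : List ι) :
    th B p D1 D2 g (l ++ m) ≤ th B p D1 D2 g l + th B p D1 D2 g m := by
  rw [th_max B hc hd p hg, th_max B hc hd p hg, th_max B hc hd p hg, wordProb_append,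
    Real.log_mul (wordProb_pos p hp l).ne' (wordProb_pos p hp m).ne']
  have a1 := le_max_left (D1 * Real.log (sx B l) + (g - D1) * Real.log (sy B l))
        (D2 * Real.log (sy B l) + (g - D2) * Real.log (sx B l))
  have a2 := le_max_right (D1 * Real.log (sx B l) + (g - D1) * Real.log (sy B l))
        (D2 * Real.log (sy B l) + (g - D2) * Real.log (sx B l))
  have b1 := le_max_left (D1 * Real.log (sx B m) + (g - D1) * Real.log (sy B m))
        (D2 * Real.log (sy B m) + (g - D2) * Real.log (sx B m))
  have b2 := le_max_right (D1 * Real.log (sx B m) + (g - D1) * Real.log (sy B m))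
        (D2 * Real.log (sy B m) + (g - D2) * Real.log (sx B m))
  rcases log_sxy B hc hd l m with ⟨h, e1, e2⟩ | ⟨h, e1, e2⟩
  · rw [e1, e2]
    rcases max_choice (D1 * (Real.log (sx B l) + Real.log (sx B m)) +
        (g - D1) * (Real.log (sy B l) + Real.log (sy B m)))
      (D2 * (Real.log (sy B l) + Real.log (sy B m)) +
        (g - D2) * (Real.log (sx B l) + Real.log (sx B m))) with k | k <;> rw [k] <;> linarith
  · rw [e1, e2]
    obtain ⟨i, hi⟩ := exists_swap_letter B m h
    obtain rfl := hD i hi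
    rcases max_choice (D1 * (Real.log (sy B l) + Real.log (sx B m)) +
        (g - D1) * (Real.log (sx B l) + Real.log (sy B m)))
      (D1 * (Real.log (sx B l) + Real.log (sy B m)) +
        (g - D1) * (Real.log (sy B l) + Real.log (sx B m))) with k | k <;> rw [k] <;> linarith

lemma th_super (B : IFSData ι) (hc : ∀ i, 0 < B.c i) (hd : ∀ i, 0 < B.d i) (p : ι → ℝ)
    (hp : ∀ i, 0 < p i) {D1 D2 g : ℝ} (hD : ∀ i, B.swap i = true → D1 = D2)
    (hg : D1 + D2 ≤ g) (l m : List ι) :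
    th B p D1 D2 g l + th B p D1 D2 g m ≤ th B p D1 D2 g (l ++ m) := by
  rw [th_min B hc hd p hg, th_min B hc hd p hg, th_min B hc hd p hg, wordProb_append,
    Real.log_mul (wordProb_pos p hp l).ne' (wordProb_pos p hp m).ne']
  have a1 := min_le_left (D1 * Real.log (sx B l) + (g - D1) * Real.log (sy B l))
        (D2 * Real.log (sy B l) + (g - D2) * Real.log (sx B l))
  have a2 := min_le_right (D1 * Real.log (sx B l) + (g - D1) * Real.log (sy B l))
        (D2 * Real.log (sy B l) + (g - D2) * Real.log (sx B l))
  have b1 := min_le_left (D1 * Real.log (sx B m) + (g - D1) * Real.log (sy B m))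
        (D2 * Real.log (sy B m) + (g - D2) * Real.log (sx B m))
  have b2 := min_le_right (D1 * Real.log (sx B m) + (g - D1) * Real.log (sy B m))
        (D2 * Real.log (sy B m) + (g - D2) * Real.log (sx B m))
  rcases log_sxy B hc hd l m with ⟨h, e1, e2⟩ | ⟨h, e1, e2⟩
  · rw [e1, e2]
    rcases min_choice (D1 * (Real.log (sx B l) + Real.log (sx B m)) +
        (g - D1) * (Real.log (sy B l) + Real.log (sy B m)))
      (D2 * (Real.log (sy B l) + Real.log (sy B m)) +
        (g - D2) * (Real.log (sx B l) + Real.log (sx B m))) with k | k <;> rw [k] <;> linarith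
  · rw [e1, e2]
    obtain ⟨i, hi⟩ := exists_swap_letter B m h
    obtain rfl := hD i hi
    rcases min_choice (D1 * (Real.log (sy B l) + Real.log (sx B m)) +
        (g - D1) * (Real.log (sx B l) + Real.log (sy B m)))
      (D1 * (Real.log (sx B l) + Real.log (sy B m)) +
        (g - D1) * (Real.log (sy B l) + Real.log (sx B m))) with k | k <;> rw [k] <;> linarith

/-- Expectation over words of length `k`. -/
def Ew [Fintype ι] (p : ι → ℝ) (k : ℕ) (F : List ι → ℝ) : ℝ :=
  ∑ f : Fin k → ι, wordProb p (List.ofFn f) * F (List.ofFn f)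

lemma sum_append [Fintype ι] (k m : ℕ) (F : List ι → ℝ) :
    ∑ f : Fin (k + m) → ι, F (List.ofFn f) =
      ∑ f : Fin k → ι, ∑ f' : Fin m → ι, F (List.ofFn f ++ List.ofFn f') := by
  rw [← Fintype.sum_prod_type', ← (Fin.appendEquiv k m).sum_comp]
  refine Finset.sum_congr rfl fun f _ => ?_
  rw [← List.ofFn_fin_append]; rfl

lemma Ew_one [Fintype ι] (p : ι → ℝ) (hp : ∑ i, p i = 1) (k : ℕ) :
    ∑ f : Fin k → ι, wordProb p (List.ofFn f) = 1 := by
  have : (∑ i, p i) ^ k = ∑ f : Fin k → ι, ∏ j, p (f j) := by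
    rw [Fintype.sum_pow]
  rw [hp, one_pow] at this
  rw [this]
  refine Finset.sum_congr rfl fun f _ => ?_
  rw [wordProb, List.map_ofFn, List.prod_ofFn]; rfl

lemma Ew_mono [Fintype ι] (p : ι → ℝ) (hp : ∀ i, 0 < p i) (k : ℕ) {F G : List ι → ℝ}
    (h : ∀ l, l.length = k → F l ≤ G l) : Ew p k F ≤ Ew p k G :=
  Finset.sum_le_sum fun f _ => mul_le_mul_of_nonneg_left (h _ (by simp)) (wordProb_pos p hp _).le

lemma Ew_sub [Fintype ι] (p : ι → ℝ) (hp : ∀ i, 0 < p i) (hps : ∑ i, p i = 1)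
    {F : List ι → ℝ} (h : ∀ l m, F (l ++ m) ≤ F l + F m) (k m : ℕ) :
    Ew p (k + m) F ≤ Ew p k F + Ew p m F := by
  unfold Ew
  rw [sum_append k m (fun l => wordProb p l * F l)]
  calc _ ≤ ∑ f : Fin k → ι, ∑ f' : Fin m → ι,
        (wordProb p (List.ofFn f) * F (List.ofFn f) * wordProb p (List.ofFn f') +
          wordProb p (List.ofFn f) * (wordProb p (List.ofFn f') * F (List.ofFn f'))) := by
        refine Finset.sum_le_sum fun f _ => Finset.sum_le_sum fun f' _ => ?_
        rw [wordProb_append]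
        have := mul_le_mul_of_nonneg_left (h (List.ofFn f) (List.ofFn f'))
          (mul_pos (wordProb_pos p hp (List.ofFn f)) (wordProb_pos p hp (List.ofFn f'))).le
        linarith
    _ = _ := by
        simp only [Finset.sum_add_distrib, ← Finset.mul_sum, ← Finset.sum_mul, Ew_one p hps]
        ring

lemma Ew_neg [Fintype ι] (p : ι → ℝ) (k : ℕ) (F : List ι → ℝ) :
    Ew p k (fun l => - F l) = - Ew p k F := by
  simp [Ew]

lemma Ew_add_mul [Fintype ι] (p : ι → ℝ) (k : ℕ) (F G : List ι → ℝ) (g : ℝ) :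
    Ew p k (fun l => F l + g * G l) = Ew p k F + g * Ew p k G := by
  simp only [Ew, mul_add, Finset.sum_add_distrib, Finset.mul_sum]
  congr 1
  exact Finset.sum_congr rfl fun f _ => by ring

lemma Ew_exp_sub [Fintype ι] (p : ι → ℝ) (hp : ∀ i, 0 < p i)
    {F : List ι → ℝ} (h : ∀ l m, F (l ++ m) ≤ F l + F m) (k m : ℕ) :
    Ew p (k + m) (fun l => Real.exp (F l)) ≤
      Ew p k (fun l => Real.exp (F l)) * Ew p m (fun l => Real.exp (F l)) := by
  unfold Ew
  rw [sum_append k m (fun l => wordProb p l * Real.exp (F l)), Finset.sum_mul_sum]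
  refine Finset.sum_le_sum fun f _ => Finset.sum_le_sum fun f' _ => ?_
  rw [wordProb_append]
  have h1 : Real.exp (F (List.ofFn f ++ List.ofFn f')) ≤
      Real.exp (F (List.ofFn f)) * Real.exp (F (List.ofFn f')) := by
    rw [← Real.exp_add]; exact Real.exp_le_exp.2 (h _ _)
  have := mul_le_mul_of_nonneg_left h1
    (mul_pos (wordProb_pos p hp (List.ofFn f)) (wordProb_pos p hp (List.ofFn f'))).le
  linarith

lemma Ew_nonneg [Fintype ι] (p : ι → ℝ) (hp : ∀ i, 0 < p i) (k : ℕ) {F : List ι → ℝ}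
    (h : ∀ l, 0 ≤ F l) : 0 ≤ Ew p k F :=
  Finset.sum_nonneg fun f _ => mul_nonneg (wordProb_pos p hp _).le (h _)

lemma Ew_exp_pow [Fintype ι] (p : ι → ℝ) (hp : ∀ i, 0 < p i)
    {F : List ι → ℝ} (h : ∀ l m, F (l ++ m) ≤ F l + F m) (k n : ℕ) :
    Ew p (k * (n + 1)) (fun l => Real.exp (F l)) ≤ Ew p k (fun l => Real.exp (F l)) ^ (n + 1) := by
  induction n with
  | zero => simp
  | succ n ih =>
    rw [show k * (n + 1 + 1) = k * (n + 1) + k by ring, pow_succ]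
    refine (Ew_exp_sub p hp h _ _).trans ?_
    exact mul_le_mul_of_nonneg_right ih (Ew_nonneg p hp k fun l => (Real.exp_pos _).le)

lemma psi_exp (B : IFSData ι) (hc : ∀ i, 0 < B.c i) (hd : ∀ i, 0 < B.d i) (p : ι → ℝ)
    (hp : ∀ i, 0 < p i) (τ1 τ2 : ℝ → ℝ) (s q : ℝ) (l : List ι) :
    psiSV B p τ1 τ2 s q l = wordProb p l * Real.exp ((q - 1) * Real.log (wordProb p l) +
      tauW B τ1 τ2 l q * lr B l + s * lm B l) := by
  have h0 := wordProb_pos p hp l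
  obtain ⟨h1, h2⟩ := alpha_pos B hc hd l
  have e : wordProb p l = Real.exp (Real.log (wordProb p l)) := (Real.exp_log h0).symm
  unfold psiSV
  rw [Real.rpow_def_of_pos h0, Real.rpow_def_of_pos h1, Real.rpow_def_of_pos h2,
    ← Real.exp_add, ← Real.exp_add]
  nth_rewrite 2 [e]
  rw [← Real.exp_add]
  congr 1
  unfold lr lm
  ring

lemma Psi_eq [Fintype ι] (B : IFSData ι) (hc : ∀ i, 0 < B.c i) (hd : ∀ i, 0 < B.d i) (p : ι → ℝ)
    (hp : ∀ i, 0 < p i) (τ1 τ2 : ℝ → ℝ) (k : ℕ) (s q : ℝ) :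
    PsiSV B p τ1 τ2 k s q = Ew p k (fun l => Real.exp ((q - 1) * Real.log (wordProb p l) +
      tauW B τ1 τ2 l q * lr B l + s * lm B l)) :=
  Finset.sum_congr rfl fun f _ => psi_exp B hc hd p hp τ1 τ2 s q _

end words

/-! ### Part 3: analytic lemmas -/

lemma implicit_deriv {A : Type*} [Fintype A] (w X' l : A → ℝ) (X : A → ℝ → ℝ) (g : ℝ → ℝ)
    (hw : ∀ a, 0 < w a) (hw1 : ∑ a, w a = 1) (hl : ∀ a, l a < 0) (hX0 : ∀ a, X a 1 = 0)
    (hX : ∀ a, HasDerivAt (X a) (X' a) 1)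
    (h : ∀ᶠ q in nhds (1 : ℝ), ∑ a, w a * Real.exp (X a q + g q * l a) = 1) :
    g 1 = 0 ∧ HasDerivAt g (-(∑ a, w a * X' a) / (∑ a, w a * l a)) 1 := by
  have hne : Nonempty A := by
    by_contra hA
    rw [not_nonempty_iff] at hA
    simp at hw1
  have hXc : ∀ a, Tendsto (X a) (nhds 1) (nhds 0) := fun a => by
    have := (hX a).continuousAt.tendsto
    rwa [hX0 a] at this
  have hΦ : ∀ s : ℝ, Tendsto (fun q => ∑ a, w a * Real.exp (X a q + s * l a)) (nhds 1)
      (nhds (∑ a, w a * Real.exp (s * l a))) := by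
    intro s
    refine tendsto_finsetSum _ fun a _ => ?_
    have := ((Real.continuous_exp.tendsto _).comp ((hXc a).add_const (s * l a))).const_mul (w a)
    rwa [zero_add] at this
  have hmono : ∀ q s s' : ℝ, s ≤ s' → ∑ a, w a * Real.exp (X a q + s' * l a) ≤
      ∑ a, w a * Real.exp (X a q + s * l a) := by
    intro q s s' hs
    refine Finset.sum_le_sum fun a _ => mul_le_mul_of_nonneg_left (Real.exp_le_exp.2 ?_) (hw a).le
    have := hl a
    nlinarith
  have hg : Tendsto g (nhds 1) (nhds 0) := by
    refine tendsto_order.2 ⟨fun ε hε => ?_, fun ε hε => ?_⟩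
    · have h1 : 1 < ∑ a, w a * Real.exp (ε * l a) := by
        nth_rewrite 1 [← hw1]
        refine Finset.sum_lt_sum_of_nonempty Finset.univ_nonempty fun a _ => ?_
        have : 1 < Real.exp (ε * l a) := Real.one_lt_exp_iff.2 (mul_pos_of_neg_of_neg hε (hl a))
        nlinarith [hw a]
      filter_upwards [h, (hΦ ε).eventually (lt_mem_nhds h1)] with q h2 h3
      by_contra hc
      have := hmono q _ _ (not_lt.1 hc)
      linarith
    · have h1 : ∑ a, w a * Real.exp (ε * l a) < 1 := by
        nth_rewrite 1 [← hw1]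
        refine Finset.sum_lt_sum_of_nonempty Finset.univ_nonempty fun a _ => ?_
        have : Real.exp (ε * l a) < 1 := Real.exp_lt_one_iff.2 (mul_neg_of_pos_of_neg hε (hl a))
        nlinarith [hw a]
      filter_upwards [h, (hΦ ε).eventually (gt_mem_nhds h1)] with q h2 h3
      by_contra hc
      have := hmono q _ _ (not_lt.1 hc)
      linarith
  have hg1 : g 1 = 0 :=
    tendsto_nhds_unique (tendsto_pure_nhds g 1) (hg.mono_left (pure_le_nhds 1))
  refine ⟨hg1, ?_⟩
  set E : A → ℝ → ℝ := fun a q => dslope Real.exp 0 (X a q + g q * l a) with hE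
  have hEt : ∀ a, Tendsto (E a) (nhds 1) (nhds 1) := by
    intro a
    have h1 : Tendsto (fun q => X a q + g q * l a) (nhds 1) (nhds 0) := by
      simpa using (hXc a).add (hg.mul_const (l a))
    have h2 : Tendsto (dslope Real.exp 0) (nhds 0) (nhds 1) := by
      have := (continuousAt_dslope_same.2 (Real.differentiableAt_exp (x := 0))).tendsto
      simpa using this
    exact h2.comp h1
  have hsum : ∀ᶠ q in nhds (1 : ℝ),
      g q * (∑ a, w a * (l a * E a q)) = -∑ a, w a * (X a q * E a q) := by
    filter_upwards [h] with q hq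
    have h3 : ∑ a, w a * ((X a q + g q * l a) * E a q) = 0 := by
      have : ∀ a, w a * ((X a q + g q * l a) * E a q) =
          w a * Real.exp (X a q + g q * l a) - w a := by
        intro a
        have := sub_smul_dslope Real.exp 0 (X a q + g q * l a)
        simp only [sub_zero, smul_eq_mul, Real.exp_zero] at this
        rw [hE]; dsimp only
        rw [this]; ring
      simp only [this, Finset.sum_sub_distrib, hq, hw1, sub_self]
    rw [eq_neg_iff_add_eq_zero, ← h3, Finset.mul_sum, ← Finset.sum_add_distrib]
    exact Finset.sum_congr rfl fun a _ => by ring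
  have hden : Tendsto (fun q => ∑ a, w a * (l a * E a q)) (nhds 1) (nhds (∑ a, w a * l a)) := by
    refine tendsto_finsetSum _ fun a _ => ?_
    simpa using ((hEt a).const_mul (l a)).const_mul (w a)
  have hneg : ∑ a, w a * l a < 0 := by
    refine Finset.sum_neg (fun a _ => mul_neg_of_pos_of_neg (hw a) (hl a)) Finset.univ_nonempty
  have hden0 : ∀ᶠ q in nhds (1 : ℝ), ∑ a, w a * (l a * E a q) < 0 :=
    hden.eventually (gt_mem_nhds hneg)
  rw [hasDerivAt_iff_tendsto_slope]
  have hnum : Tendsto (fun q => -∑ a, w a * (slope (X a) 1 q * E a q)) (nhdsWithin 1 {1}ᶜ)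
      (nhds (-∑ a, w a * X' a)) := by
    refine (tendsto_finsetSum _ fun a _ => ?_).neg
    have h1 := hasDerivAt_iff_tendsto_slope.1 (hX a)
    simpa using (h1.mul ((hEt a).mono_left nhdsWithin_le_nhds)).const_mul (w a)
  refine (hnum.div (hden.mono_left nhdsWithin_le_nhds) hneg.ne).congr' ?_
  filter_upwards [nhdsWithin_le_nhds hsum, nhdsWithin_le_nhds hden0, self_mem_nhdsWithin]
    with q h1 h2 h3
  have h3' : q - 1 ≠ 0 := sub_ne_zero.2 h3
  rw [Pi.div_apply, div_eq_iff h2.ne, slope_def_field, hg1, sub_zero, div_mul_eq_mul_div, h1,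
    eq_div_iff h3', neg_mul, Finset.sum_mul]
  congr 1
  refine Finset.sum_congr rfl fun a _ => ?_
  rw [slope_def_field, hX0 a]
  field_simp
  ring

/-- Fekete-type lemma for the zeros `-N k / M k`. -/
lemma fekete_zeros (N M : ℕ → ℝ) {c gs D : ℝ} (hc : 0 < c)
    (hM : ∀ k, 1 ≤ k → M k ≤ -(c * k))
    (hsub : ∀ g, g ≤ gs → Subadditive fun k => N k + g * M k)
    (hle : ∀ k, 1 ≤ k → -N k / M k ≤ gs) (hD : ∀ k, 1 ≤ k → D ≤ -N k / M k) :
    ∃ L : ℝ, Tendsto (fun k => -N k / M k) atTop (nhds L) ∧ (∀ k, 1 ≤ k → L ≤ -N k / M k) ∧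
      D ≤ L := by
  set G : ℕ → ℝ := fun k => -N k / M k with hG
  have hMneg : ∀ k, 1 ≤ k → M k < 0 := fun k hk => by
    have h1 := hM k hk
    have : (0 : ℝ) < k := by exact_mod_cast hk
    have : 0 < c * k := by positivity
    linarith
  set S : Set ℝ := G '' Ici 1 with hS
  have hSn : S.Nonempty := ⟨G 1, 1, by simp, rfl⟩
  have hSb : BddBelow S := ⟨D, by rintro _ ⟨k, hk, rfl⟩; exact hD k hk⟩
  have hlow : ∀ k, 1 ≤ k → sInf S ≤ G k := fun k hk => csInf_le hSb ⟨k, hk, rfl⟩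
  refine ⟨sInf S, ?_, hlow, le_csInf hSn (by rintro _ ⟨k, hk, rfl⟩; exact hD k hk)⟩
  refine tendsto_order.2 ⟨fun b hb => ?_, fun b hb => ?_⟩
  · filter_upwards [eventually_ge_atTop 1] with k hk using hb.trans_le (hlow k hk)
  · obtain ⟨_, ⟨m, hm, rfl⟩, hmb⟩ := exists_lt_of_csInf_lt hSn hb
    have hm1 : 1 ≤ m := hm
    have hz : N m + G m * M m = 0 := by
      have := (hMneg m hm1).ne
      rw [hG]; field_simp; ring
    have hε : 0 < b - G m := by linarith
    have h1 := (hsub (G m) (hle m hm1)).eventually_div_lt_of_div_lt (L := c * (b - G m))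
      (n := m) (by omega) (by rw [hz, zero_div]; positivity)
    filter_upwards [h1, eventually_ge_atTop 1] with k hk hk1
    have hk0 : (0 : ℝ) < k := by exact_mod_cast hk1
    rw [div_lt_iff₀ hk0] at hk
    have hNk : N k = -G k * M k := by
      have := (hMneg k hk1).ne
      rw [hG]; field_simp
    by_contra hcon
    have hcon : b ≤ G k := not_lt.1 hcon
    have h2 := hM k hk1
    rw [hNk] at hk
    nlinarith [mul_nonneg (sub_nonneg.2 hcon) (hk0.le), mul_le_mul_of_nonneg_left h2 (show 0 ≤ G k - G m by linarith),
      mul_nonneg (mul_nonneg (sub_nonneg.2 hcon) hc.le) hk0.le]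

lemma right_deriv_le {γ H : ℝ → ℝ} {Dp g : ℝ} (h : HasDerivWithinAt γ Dp (Ici 1) 1)
    (h1 : γ 1 = 0) (hH : H =o[nhds 1] fun q : ℝ => q - 1)
    (hle : ∀ q, 1 ≤ q → γ q ≤ (q - 1) * g + |H q|) : Dp ≤ g := by
  have h2 := (hasDerivWithinAt_iff_tendsto_slope' (by simp)).1 h.Ioi_of_Ici
  have h3 : Tendsto (fun q => g + |H q / (q - 1)|) (nhdsWithin 1 (Ioi 1)) (nhds (g + |0|)) :=
    ((hH.tendsto_div_nhds_zero.mono_left nhdsWithin_le_nhds).abs).const_add g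
  rw [abs_zero, add_zero] at h3
  refine le_of_tendsto_of_tendsto h2 h3 ?_
  filter_upwards [self_mem_nhdsWithin] with q hq
  have hq' : 0 < q - 1 := sub_pos.2 hq
  rw [slope_def_field, h1, sub_zero, abs_div, abs_of_pos hq', div_le_iff₀ hq', add_mul,
    div_mul_cancel₀ _ hq'.ne']
  have := hle q (le_of_lt hq)
  linarith

lemma le_left_deriv {γ H : ℝ → ℝ} {Dm g : ℝ} (h : HasDerivWithinAt γ Dm (Iic 1) 1)
    (h1 : γ 1 = 0) (hH : H =o[nhds 1] fun q : ℝ => q - 1)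
    (hle : ∀ q, 0 ≤ q → q ≤ 1 → γ q ≤ (q - 1) * g + |H q|) : g ≤ Dm := by
  have h2 := (hasDerivWithinAt_iff_tendsto_slope' (by simp)).1 h.Iio_of_Iic
  have h3 : Tendsto (fun q => g - |H q / (q - 1)|) (nhdsWithin 1 (Iio 1)) (nhds (g - |0|)) :=
    ((hH.tendsto_div_nhds_zero.mono_left nhdsWithin_le_nhds).abs).const_sub g
  rw [abs_zero, sub_zero] at h3
  refine le_of_tendsto_of_tendsto h3 h2 ?_
  filter_upwards [self_mem_nhdsWithin,
    nhdsWithin_le_nhds (lt_mem_nhds (show (0 : ℝ) < 1 by norm_num))] with q hq hq0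
  have hq' : q - 1 < 0 := sub_neg.2 hq
  rw [slope_def_field, h1, sub_zero, abs_div, abs_of_neg hq', le_div_iff_of_neg hq', sub_mul]
  have e : |H q| / -(q - 1) * (q - 1) = -|H q| := by
    have := hq'.ne
    rw [div_neg, neg_mul, div_mul_cancel₀ _ this]
  rw [e]
  have := hle q (le_of_lt hq0) (le_of_lt hq)
  linarith

lemma holder_exp {A : Type*} [Fintype A] [Nonempty A] (w X Y Z : A → ℝ) (hw : ∀ a, 0 < w a) {a b : ℝ}
    (ha : 0 < a) (hb : 0 < b) (hab : a + b = 1) (hZ : ∀ i, Z i ≤ a * X i + b * Y i) :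
    ∑ i, w i * Real.exp (Z i) ≤
      (∑ i, w i * Real.exp (X i)) ^ a * (∑ i, w i * Real.exp (Y i)) ^ b := by
  set P := ∑ i, w i * Real.exp (X i) with hP
  set Q := ∑ i, w i * Real.exp (Y i) with hQ
  have hP0 : 0 < P := Finset.sum_pos (fun i _ => mul_pos (hw i) (Real.exp_pos _)) Finset.univ_nonempty
  have hQ0 : 0 < Q := Finset.sum_pos (fun i _ => mul_pos (hw i) (Real.exp_pos _)) Finset.univ_nonempty
  have h1 : ∀ i, w i * Real.exp (Z i) ≤
      (P ^ a * Q ^ b) * (a * (w i * Real.exp (X i) / P) + b * (w i * Real.exp (Y i) / Q)) := by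
    intro i
    have h2 := Real.geom_mean_le_arith_mean2_weighted ha.le hb.le
      (p₁ := Real.exp (X i) / P) (p₂ := Real.exp (Y i) / Q) (by positivity) (by positivity) hab
    rw [Real.div_rpow (by positivity) hP0.le, Real.div_rpow (by positivity) hQ0.le,
      ← Real.exp_mul, ← Real.exp_mul] at h2
    have hPa := Real.rpow_pos_of_pos hP0 a
    have hQb := Real.rpow_pos_of_pos hQ0 b
    have h3 : Real.exp (Z i) ≤ Real.exp (X i * a) * Real.exp (Y i * b) := by
      rw [← Real.exp_add]; apply Real.exp_le_exp.2; linarith [hZ i]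
    have h4 := mul_le_mul_of_nonneg_left h2 (mul_pos (mul_pos hPa hQb) (hw i)).le
    calc w i * Real.exp (Z i) ≤ w i * (Real.exp (X i * a) * Real.exp (Y i * b)) :=
          mul_le_mul_of_nonneg_left h3 (hw i).le
      _ = (P ^ a * Q ^ b) * w i * (Real.exp (X i * a) / P ^ a * (Real.exp (Y i * b) / Q ^ b)) := by
          field_simp
      _ ≤ _ := h4
      _ = _ := by ring
  refine (Finset.sum_le_sum fun i _ => h1 i).trans (le_of_eq ?_)
  rw [← Finset.mul_sum, Finset.sum_add_distrib, ← Finset.mul_sum, ← Finset.mul_sum,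
    ← Finset.sum_div, ← Finset.sum_div, ← hP, ← hQ, div_self hP0.ne', div_self hQ0.ne', mul_one,
    mul_one, hab, mul_one]

/-! ### Part 4: pressure estimates -/

section pressure
variable {ι : Type} [Fintype ι]

lemma Ew_pos [Nonempty ι] (p : ι → ℝ) (hp : ∀ i, 0 < p i) (k : ℕ) {F : List ι → ℝ}
    (h : ∀ l, 0 < F l) : 0 < Ew p k F :=
  Finset.sum_pos (fun _ _ => mul_pos (wordProb_pos p hp _) (h _)) Finset.univ_nonempty

lemma Ew_const (p : ι → ℝ) (hps : ∑ i, p i = 1) (k : ℕ) (c : ℝ) :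
    Ew p k (fun _ => c) = c := by
  unfold Ew
  rw [← Finset.sum_mul, Ew_one p hps, one_mul]

lemma Psi_mono (B : IFSData ι) (hc : ∀ i, 0 < B.c i) (hd : ∀ i, 0 < B.d i) (p : ι → ℝ)
    (hp : ∀ i, 0 < p i) (τ1 τ2 : ℝ → ℝ) {a : ℝ} (ha : ∀ l : List ι, lm B l ≤ -(a * l.length))
    (k : ℕ) (s q h : ℝ) (hh : 0 ≤ h) :
    PsiSV B p τ1 τ2 k (s + h) q ≤ Real.exp (-(a * h) * k) * PsiSV B p τ1 τ2 k s q := by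
  rw [Psi_eq B hc hd p hp, Psi_eq B hc hd p hp]
  unfold Ew
  rw [Finset.mul_sum]
  refine Finset.sum_le_sum fun f _ => ?_
  rw [mul_left_comm, ← Real.exp_add]
  refine mul_le_mul_of_nonneg_left (Real.exp_le_exp.2 ?_) (wordProb_pos p hp _).le
  have := ha (List.ofFn f)
  rw [List.length_ofFn] at this
  nlinarith

lemma Psi_nonneg (B : IFSData ι) (hc : ∀ i, 0 < B.c i) (hd : ∀ i, 0 < B.d i) (p : ι → ℝ)
    (hp : ∀ i, 0 < p i) (τ1 τ2 : ℝ → ℝ) (k : ℕ) (s q : ℝ) : 0 ≤ PsiSV B p τ1 τ2 k s q := by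
  rw [Psi_eq B hc hd p hp]
  exact Ew_nonneg p hp k fun l => (Real.exp_pos _).le

lemma exp_root (x : ℝ) {k : ℕ} (hk : 1 ≤ k) : Real.exp (x * k) ^ ((k : ℝ)⁻¹) = Real.exp x := by
  have : (k : ℝ) ≠ 0 := by positivity
  rw [← Real.exp_mul, mul_assoc, mul_inv_cancel₀ this, mul_one]

lemma P_mono (B : IFSData ι) (hc : ∀ i, 0 < B.c i) (hd : ∀ i, 0 < B.d i) (p : ι → ℝ)
    (hp : ∀ i, 0 < p i) (τ1 τ2 : ℝ → ℝ) {a : ℝ} (ha : ∀ l : List ι, lm B l ≤ -(a * l.length))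
    (P : ℝ → ℝ → ℝ)
    (hP : ∀ s q : ℝ, 0 ≤ q →
      Tendsto (fun k : ℕ => PsiSV B p τ1 τ2 k s q ^ ((k : ℝ)⁻¹)) atTop (nhds (P s q)))
    (s q h : ℝ) (hq : 0 ≤ q) (hh : 0 ≤ h) : P (s + h) q ≤ Real.exp (-(a * h)) * P s q := by
  refine le_of_tendsto_of_tendsto (hP _ _ hq) ((hP _ _ hq).const_mul _) ?_
  filter_upwards [eventually_ge_atTop 1] with k hk
  have h1 := Psi_mono B hc hd p hp τ1 τ2 ha k s q h hh
  have h2 := Real.rpow_le_rpow (Psi_nonneg B hc hd p hp τ1 τ2 k _ q) h1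
    (show 0 ≤ ((k : ℝ)⁻¹) by positivity)
  rwa [Real.mul_rpow (Real.exp_pos _).le (Psi_nonneg B hc hd p hp τ1 τ2 k _ q), exp_root _ hk] at h2

lemma gamma_le {P : ℝ → ℝ → ℝ} {a : ℝ} (ha : 0 < a)
    (hPm : ∀ s q h : ℝ, 0 ≤ q → 0 ≤ h → P (s + h) q ≤ Real.exp (-(a * h)) * P s q)
    {γ s q b : ℝ} (hq : 0 ≤ q) (hb : 0 ≤ b) (hγ : P γ q = 1) (hs : P s q ≤ Real.exp (a * b)) :
    γ ≤ s + b := by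
  by_contra hcon
  have hcon : s + b < γ := not_le.1 hcon
  have h1 := hPm s q (γ - s) hq (by linarith)
  rw [add_sub_cancel, hγ] at h1
  have h2 := h1.trans (mul_le_mul_of_nonneg_left hs (Real.exp_pos _).le)
  rw [← Real.exp_add] at h2
  have h3 : Real.exp (-(a * (γ - s)) + a * b) < 1 := Real.exp_lt_one_iff.2 (by nlinarith)
  linarith

lemma gamma_convex [Nonempty ι] (B : IFSData ι) (hc : ∀ i, 0 < B.c i) (hd : ∀ i, 0 < B.d i)
    (p : ι → ℝ) (hp : ∀ i, 0 < p i) (τ1 τ2 : ℝ → ℝ) {a : ℝ} (ha : 0 < a)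
    (P : ℝ → ℝ → ℝ)
    (hP : ∀ s q : ℝ, 0 ≤ q →
      Tendsto (fun k : ℕ => PsiSV B p τ1 τ2 k s q ^ ((k : ℝ)⁻¹)) atTop (nhds (P s q)))
    (hPm : ∀ s q h : ℝ, 0 ≤ q → 0 ≤ h → P (s + h) q ≤ Real.exp (-(a * h)) * P s q)
    (h1 : ConvexOn ℝ (Ici 0) τ1) (h2 : ConvexOn ℝ (Ici 0) τ2)
    (γ : ℝ → ℝ) (hγ : ∀ q : ℝ, 0 ≤ q → P (γ q) q = 1) : ConvexOn ℝ (Ici 0) γ := by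
  refine convexOn_iff_forall_pos.2 ⟨convex_Ici 0, fun x hx y hy b c hb hc' hbc => ?_⟩
  have hx0 : 0 ≤ x := hx
  have hy0 : 0 ≤ y := hy
  simp only [smul_eq_mul]
  have hm : 0 ≤ b * x + c * y := by positivity
  have key : P (b * γ x + c * γ y) (b * x + c * y) ≤ 1 := by
    have h3 := ((hP (γ x) x hx0).rpow_const (p := b) (Or.inr hb.le)).mul
      ((hP (γ y) y hy0).rpow_const (p := c) (Or.inr hc'.le))
    rw [hγ x hx0, hγ y hy0, Real.one_rpow, Real.one_rpow, mul_one] at h3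
    refine le_of_tendsto_of_tendsto' (hP _ _ hm) h3 fun k => ?_
    have n1 := Psi_nonneg B hc hd p hp τ1 τ2 k (γ x) x
    have n2 := Psi_nonneg B hc hd p hp τ1 τ2 k (γ y) y
    have h4 : PsiSV B p τ1 τ2 k (b * γ x + c * γ y) (b * x + c * y) ≤
        PsiSV B p τ1 τ2 k (γ x) x ^ b * PsiSV B p τ1 τ2 k (γ y) y ^ c := by
      rw [Psi_eq B hc hd p hp, Psi_eq B hc hd p hp, Psi_eq B hc hd p hp]
      unfold Ew
      refine holder_exp _ _ _ _ (fun f => wordProb_pos p hp _) hb hc' hbc fun f => ?_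
      have h5 : tauW B τ1 τ2 (List.ofFn f) (b * x + c * y) ≤
          b * tauW B τ1 τ2 (List.ofFn f) x + c * tauW B τ1 τ2 (List.ofFn f) y := by
        unfold tauW
        split_ifs
        · exact h1.2 hx hy hb.le hc'.le hbc
        · exact h2.2 hx hy hb.le hc'.le hbc
      have h6 := mul_le_mul_of_nonneg_right h5 (lr_nonneg B hc hd (List.ofFn f))
      have h7 : b * x + c * y - 1 = b * (x - 1) + c * (y - 1) := by linear_combination hbc
      rw [h7]
      linarith
    have h8 := Real.rpow_le_rpow (Psi_nonneg B hc hd p hp τ1 τ2 k _ _) h4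
      (show 0 ≤ ((k : ℝ)⁻¹) by positivity)
    have hcomm : ∀ x u v : ℝ, 0 ≤ x → (x ^ u) ^ v = (x ^ v) ^ u := fun x u v hx => by
      rw [← Real.rpow_mul hx, mul_comm, Real.rpow_mul hx]
    rwa [Real.mul_rpow (by positivity) (by positivity), hcomm _ b _ n1, hcomm _ c _ n2] at h8
  have := gamma_le ha hPm (b := 0) hm le_rfl (hγ _ hm) (s := b * γ x + c * γ y) (by simpa using key)
  linarith

lemma upper [Nonempty ι] (B : IFSData ι) (hc : ∀ i, 0 < B.c i) (hd : ∀ i, 0 < B.d i)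
    (p : ι → ℝ) (hp : ∀ i, 0 < p i) (hps : ∑ i, p i = 1) (τ1 τ2 : ℝ → ℝ) {a C : ℝ} (ha : 0 < a)
    (hC0 : 0 < C) (hC : ∀ l : List ι, lr B l ≤ C * l.length)
    (P : ℝ → ℝ → ℝ)
    (hP : ∀ s q : ℝ, 0 ≤ q →
      Tendsto (fun k : ℕ => PsiSV B p τ1 τ2 k s q ^ ((k : ℝ)⁻¹)) atTop (nhds (P s q)))
    (hPm : ∀ s q h : ℝ, 0 ≤ q → 0 ≤ h → P (s + h) q ≤ Real.exp (-(a * h)) * P s q)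
    (γ : ℝ → ℝ) (hγ : ∀ q : ℝ, 0 ≤ q → P (γ q) q = 1)
    {D1 D2 : ℝ} (hτ1 : HasDerivAt τ1 D1 1) (hτ2 : HasDerivAt τ2 D2 1)
    (h10 : τ1 1 = 0) (h20 : τ2 1 = 0)
    {k : ℕ} (hk : 1 ≤ k) {g : ℝ} (hg : Ew p k (th B p D1 D2 g) = 0) :
    ∃ H : ℝ → ℝ, H =o[nhds 1] (fun q : ℝ => q - 1) ∧ ∀ q, 0 ≤ q →
      (∀ l m, (q - 1) * th B p D1 D2 g (l ++ m) ≤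
        (q - 1) * th B p D1 D2 g l + (q - 1) * th B p D1 D2 g m) →
      γ q ≤ (q - 1) * g + |H q| := by
  set E : ℝ → ℝ := fun q => Ew p k (fun l => Real.exp ((q - 1) * th B p D1 D2 g l)) with hE
  set ω : ℝ → ℝ := fun q => |τ1 q - (q - 1) * D1| + |τ2 q - (q - 1) * D2| with hω
  have hE0 : ∀ q, 0 < E q := fun q => Ew_pos p hp k fun l => Real.exp_pos _
  have hE1 : E 1 = 1 := by
    simp only [hE, sub_self, zero_mul, Real.exp_zero, Ew_const p hps]
  have hlogE : (fun q => Real.log (E q)) =o[nhds 1] (fun q : ℝ => q - 1) := by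
    have hEd : HasDerivAt E 0 1 := by
      rw [← hg]
      simp only [hE, Ew]
      refine HasDerivAt.fun_sum fun f _ => ?_
      have h1 : HasDerivAt (fun q : ℝ => (q - 1) * th B p D1 D2 g (List.ofFn f))
          (1 * th B p D1 D2 g (List.ofFn f)) 1 :=
        ((hasDerivAt_id (1 : ℝ)).sub_const 1).mul_const _
      have h2 := (h1.exp).const_mul (wordProb p (List.ofFn f))
      simpa using h2
    have h3 := (hEd.log (hE0 1).ne').isLittleO
    simpa [hE1] using h3
  have ho1 : (fun q => τ1 q - (q - 1) * D1) =o[nhds 1] (fun q : ℝ => q - 1) := by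
    simpa [h10] using hτ1.isLittleO
  have ho2 : (fun q => τ2 q - (q - 1) * D2) =o[nhds 1] (fun q : ℝ => q - 1) := by
    simpa [h20] using hτ2.isLittleO
  have hωo : ω =o[nhds 1] (fun q : ℝ => q - 1) := by
    have := ho1.norm_left.add ho2.norm_left
    simpa only [Real.norm_eq_abs] using this
  refine ⟨fun q => a⁻¹ * (C * ω q + (k : ℝ)⁻¹ * Real.log (E q)),
    ((hωo.const_mul_left C).add (hlogE.const_mul_left _)).const_mul_left _, fun q hq hsub => ?_⟩
  refine gamma_le ha hPm hq (abs_nonneg _) (hγ q hq) ?_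
  have hk0 : (0 : ℝ) < k := by exact_mod_cast hk
  have hω0 : 0 ≤ ω q := by positivity
  have key : P ((q - 1) * g) q ≤ Real.exp (C * ω q + (k : ℝ)⁻¹ * Real.log (E q)) := by
    have ht : Tendsto (fun n : ℕ => k * (n + 1)) atTop atTop := by
      refine tendsto_atTop_mono (fun n => ?_) tendsto_id
      simp only [id]
      nlinarith
    refine le_of_tendsto' ((hP ((q - 1) * g) q hq).comp ht) fun n => ?_
    simp only [Function.comp]
    have hkn : 1 ≤ k * (n + 1) := by nlinarith
    have h1 : PsiSV B p τ1 τ2 (k * (n + 1)) ((q - 1) * g) q ≤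
        Real.exp ((C * ω q) * (k * (n + 1) : ℕ)) * E q ^ (n + 1) := by
      have h2 := Ew_exp_pow p hp (F := fun l => (q - 1) * th B p D1 D2 g l) hsub k n
      refine le_trans ?_ (mul_le_mul_of_nonneg_left h2 (Real.exp_pos _).le)
      rw [Psi_eq B hc hd p hp]
      unfold Ew
      rw [Finset.mul_sum]
      refine Finset.sum_le_sum fun f _ => ?_
      rw [mul_left_comm, ← Real.exp_add]
      refine mul_le_mul_of_nonneg_left (Real.exp_le_exp.2 ?_) (wordProb_pos p hp _).le
      have h3 := hC (List.ofFn f)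
      rw [List.length_ofFn] at h3
      have h4 := lr_nonneg B hc hd (List.ofFn f)
      have h5 : tauW B τ1 τ2 (List.ofFn f) q -
          (q - 1) * (if B.usesPi1 (List.ofFn f) then D1 else D2) ≤ ω q := by
        unfold tauW
        have b1 := abs_nonneg (τ1 q - (q - 1) * D1)
        have b2 := abs_nonneg (τ2 q - (q - 1) * D2)
        split_ifs
        · have := le_abs_self (τ1 q - (q - 1) * D1); simp only [hω]; linarith
        · have := le_abs_self (τ2 q - (q - 1) * D2); simp only [hω]; linarith
      have h6 := mul_le_mul_of_nonneg_right h5 h4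
      have h7 := mul_le_mul_of_nonneg_left h3 hω0
      unfold th
      linarith
    have h8 := Real.rpow_le_rpow (Psi_nonneg B hc hd p hp τ1 τ2 _ _ _) h1
      (show 0 ≤ (((k * (n + 1) : ℕ) : ℝ)⁻¹) by positivity)
    refine h8.trans (le_of_eq ?_)
    rw [Real.mul_rpow (Real.exp_pos _).le (pow_nonneg (hE0 q).le _), exp_root _ hkn, Real.exp_add]
    congr 1
    rw [← Real.rpow_natCast, ← Real.rpow_mul (hE0 q).le, Real.rpow_def_of_pos (hE0 q)]
    congr 1
    push_cast
    have : (n : ℝ) + 1 ≠ 0 := by positivity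
    field_simp
  refine key.trans (Real.exp_le_exp.2 ?_)
  have h1 := mul_le_mul_of_nonneg_left
    (le_abs_self (a⁻¹ * (C * ω q + (k : ℝ)⁻¹ * Real.log (E q)))) ha.le
  rwa [mul_inv_cancel_left₀ ha.ne'] at h1

end pressure


/-! ### Part 5: projections and assembly -/

lemma proj_support (μ : Measure (ℝ × ℝ)) (hcpt : ∃ K : Set (ℝ × ℝ), IsCompact K ∧ μ Kᶜ = 0) :
    ∃ R : ℝ, 0 ≤ R ∧ Measure.map Prod.fst μ (Icc (-R) R)ᶜ = 0 ∧
      Measure.map Prod.snd μ (Icc (-R) R)ᶜ = 0 := by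
  obtain ⟨K, hK, hK0⟩ := hcpt
  obtain ⟨R, hR⟩ := hK.isBounded.exists_norm_le
  refine ⟨max R 0, le_max_right _ _, ?_, ?_⟩
  · rw [Measure.map_apply measurable_fst measurableSet_Icc.compl]
    refine measure_mono_null (t := Kᶜ) (fun x hx hxK => hx ?_) hK0
    have h1 := (norm_fst_le x).trans ((hR x hxK).trans (le_max_left R 0))
    exact abs_le.1 h1
  · rw [Measure.map_apply measurable_snd measurableSet_Icc.compl]
    refine measure_mono_null (t := Kᶜ) (fun x hx hxK => hx ?_) hK0
    have h1 := (norm_snd_le x).trans ((hR x hxK).trans (le_max_left R 0))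
    exact abs_le.1 h1

lemma affine_contract (b : Bool) {c : ℝ} (hc : c ∈ Ioo (0 : ℝ) 1) (t : ℝ) (x y : ℝ) :
    dist ((if b = true then (1 : ℝ) else -1) * (c * x) + t)
      ((if b = true then (1 : ℝ) else -1) * (c * y) + t) ≤ dist x y := by
  rw [Real.dist_eq, Real.dist_eq]
  have h : (if b = true then (1 : ℝ) else -1) * (c * x) + t -
      ((if b = true then (1 : ℝ) else -1) * (c * y) + t) =
      (if b = true then (1 : ℝ) else -1) * (c * (x - y)) := by ring
  rw [h, abs_mul, abs_mul, abs_of_pos hc.1]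
  have h2 : |(if b = true then (1 : ℝ) else -1)| = 1 := by cases b <;> simp
  rw [h2, one_mul]
  have := abs_nonneg (x - y)
  nlinarith [hc.2]

lemma S_measurable {ι : Type} (B : IFSData ι) (i : ι) : Measurable (B.S i) := by
  unfold IFSData.S
  cases B.swap i <;> cases B.sgn1 i <;> cases B.sgn2 i <;> simp <;> fun_prop

lemma swap_tau_eq {ι : Type} [Fintype ι] (B : IFSData ι)
    (hc : ∀ i, B.c i ∈ Set.Ioo (0 : ℝ) 1) (hd : ∀ i, B.d i ∈ Set.Ioo (0 : ℝ) 1)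
    (p : ι → ℝ) (hp : ∀ i, 0 < p i)
    (μ : Measure (ℝ × ℝ)) [IsProbabilityMeasure μ]
    (hself : μ = ∑ i : ι, ENNReal.ofReal (p i) • Measure.map (B.S i) μ)
    {R : ℝ} (hR : 0 ≤ R) (hR1 : Measure.map Prod.fst μ (Icc (-R) R)ᶜ = 0)
    (hR2 : Measure.map Prod.snd μ (Icc (-R) R)ᶜ = 0) (i : ι) (hi : B.swap i = true)
    {q t1 t2 : ℝ} (hq : 1 ≤ q)
    (h1 : IsLqSpec (Measure.map Prod.fst μ) q t1) (h2 : IsLqSpec (Measure.map Prod.snd μ) q t2) :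
    t1 = t2 := by
  haveI : IsProbabilityMeasure (Measure.map Prod.fst μ) :=
    Measure.isProbabilityMeasure_map measurable_fst.aemeasurable
  haveI : IsProbabilityMeasure (Measure.map Prod.snd μ) :=
    Measure.isProbabilityMeasure_map measurable_snd.aemeasurable
  have hS := S_measurable B i
  have hle : ENNReal.ofReal (p i) • Measure.map (B.S i) μ ≤ μ := by
    conv_rhs => rw [hself]
    exact Finset.single_le_sum (f := fun i => ENNReal.ofReal (p i) • Measure.map (B.S i) μ)
      (fun _ _ => Measure.zero_le _) (Finset.mem_univ i)
  set A1 : ℝ → ℝ := fun y => (if B.sgn1 i = true then (1 : ℝ) else -1) * (B.c i * y) + (B.t i).1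
    with hA1
  set A2 : ℝ → ℝ := fun y => (if B.sgn2 i = true then (1 : ℝ) else -1) * (B.d i * y) + (B.t i).2
    with hA2
  have m1 : Measurable A1 := by simp only [hA1]; fun_prop
  have m2 : Measurable A2 := by simp only [hA2]; fun_prop
  have e1 : Prod.fst ∘ B.S i = A1 ∘ Prod.snd := by
    funext x
    simp [IFSData.S, hi, hA1]
  have e2 : Prod.snd ∘ B.S i = A2 ∘ Prod.fst := by
    funext x
    simp [IFSData.S, hi, hA2]
  apply le_antisymm
  · refine tau_compare _ _ hR hR2 hR1 (hp i) m2 (affine_contract _ (hd i) _) ?_ hq h2 h1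
    have := Measure.map_mono hle measurable_snd
    rwa [Measure.map_smul, Measure.map_map measurable_snd hS, e2,
      ← Measure.map_map m2 measurable_fst] at this
  · refine tau_compare _ _ hR hR1 hR2 (hp i) m1 (affine_contract _ (hc i) _) ?_ hq h1 h2
    have := Measure.map_mono hle measurable_fst
    rwa [Measure.map_smul, Measure.map_map measurable_fst hS, e1,
      ← Measure.map_map m1 measurable_snd] at this

theorem one_sided_derivative_estimates_for_gamma
    {ι : Type} [Fintype ι] [Nonempty ι] (hcard : 2 ≤ Fintype.card ι)
    (B : IFSData ι)
    (hc : ∀ i, B.c i ∈ Set.Ioo (0 : ℝ) 1) (hd : ∀ i, B.d i ∈ Set.Ioo (0 : ℝ) 1)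
    (p : ι → ℝ) (hp : ∀ i, p i ∈ Set.Ioo (0 : ℝ) 1) (hpsum : ∑ i : ι, p i = 1)
    (μ : Measure (ℝ × ℝ)) [IsProbabilityMeasure μ]
    (hcpt : ∃ K : Set (ℝ × ℝ), IsCompact K ∧ μ Kᶜ = 0)
    (hself : μ = ∑ i : ι, ENNReal.ofReal (p i) • Measure.map (B.S i) μ)
    (τ1 τ2 : ℝ → ℝ)
    (hτ1 : ∀ q : ℝ, 0 ≤ q → IsLqSpec (Measure.map Prod.fst μ) q (τ1 q))
    (hτ2 : ∀ q : ℝ, 0 ≤ q → IsLqSpec (Measure.map Prod.snd μ) q (τ2 q))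
    (P : ℝ → ℝ → ℝ)
    (hP : ∀ s q : ℝ, 0 ≤ q →
      Tendsto (fun k : ℕ => PsiSV B p τ1 τ2 k s q ^ ((k : ℝ)⁻¹)) atTop (nhds (P s q)))
    (γ : ℝ → ℝ) (hγ : ∀ q : ℝ, 0 ≤ q → P (γ q) q = 1)
    (γks : ℕ → ℝ → ℝ)
    (hγks : ∀ k : ℕ, 1 ≤ k → ∀ q : ℝ, 0 ≤ q → PsiSV B p τ1 τ2 k (γks k q) q = 1)
     :
    ∀ D1 D2 g1 : ℝ, HasDerivAt τ1 D1 1 → HasDerivAt τ2 D2 1 →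
      HasDerivAt (γks 1) g1 1 →
      ∃ Dm Dp : ℝ, HasDerivWithinAt γ Dm (Set.Iic 1) 1 ∧ HasDerivWithinAt γ Dp (Set.Ici 1) 1 ∧
        ((g1 ≤ D1 + D2 →
            ∃ g : ℕ → ℝ, (∀ k : ℕ, 1 ≤ k → HasDerivAt (γks k) (g k) 1) ∧
              ∃ L : ℝ, Tendsto g atTop (nhds L) ∧ (∀ k : ℕ, 1 ≤ k → L ≤ g k) ∧
                Dp ≤ L ∧ Dm ≤ Dp) ∧
         (D1 + D2 ≤ g1 →
            ∃ g : ℕ → ℝ, (∀ k : ℕ, 1 ≤ k → HasDerivAt (γks k) (g k) 1) ∧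
              ∃ L : ℝ, Tendsto g atTop (nhds L) ∧ (∀ k : ℕ, 1 ≤ k → g k ≤ L) ∧
                L ≤ Dm ∧ Dm ≤ Dp)) := by
  intro D1 D2 g1 hD1 hD2 hg1
  have hc0 : ∀ i, 0 < B.c i := fun i => (hc i).1
  have hd0 : ∀ i, 0 < B.d i := fun i => (hd i).1
  have hp0 : ∀ i, 0 < p i := fun i => (hp i).1
  obtain ⟨R, hR, hR1, hR2⟩ := proj_support μ hcpt
  haveI : IsProbabilityMeasure (Measure.map Prod.fst μ) :=
    Measure.isProbabilityMeasure_map measurable_fst.aemeasurable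
  haveI : IsProbabilityMeasure (Measure.map Prod.snd μ) :=
    Measure.isProbabilityMeasure_map measurable_snd.aemeasurable
  have hcv1 := tau_convex _ hR hR1 hτ1
  have hcv2 := tau_convex _ hR hR2 hτ2
  have h10 : τ1 1 = 0 := tau_one _ hR hR1 (hτ1 1 zero_le_one)
  have h20 : τ2 1 = 0 := tau_one _ hR hR2 (hτ2 1 zero_le_one)
  have hD : ∀ i, B.swap i = true → D1 = D2 := by
    intro i hi
    have heq : ∀ q, 1 ≤ q → τ1 q = τ2 q := fun q hq =>
      swap_tau_eq B hc hd p hp0 μ hself hR hR1 hR2 i hi hq (hτ1 q (by linarith))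
        (hτ2 q (by linarith))
    have e1 : HasDerivWithinAt τ1 D1 (Ici 1) 1 := hD1.hasDerivWithinAt
    have e2 : HasDerivWithinAt τ1 D2 (Ici 1) 1 :=
      (hD2.hasDerivWithinAt (s := Ici 1)).congr (fun q hq => heq q hq) (heq 1 le_rfl)
    exact (uniqueDiffOn_Ici (1 : ℝ) 1 (by simp)).eq_deriv _ e1 e2
  obtain ⟨a, C, ha, hC, hb⟩ := log_bounds B hc hd
  have hPm := P_mono B hc0 hd0 p hp0 τ1 τ2 (fun l => (hb l).1) P hP
  have hγc := gamma_convex B hc0 hd0 p hp0 τ1 τ2 ha P hP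
    (fun s q h hq hh => hPm s q h hq hh) hcv1 hcv2 γ hγ
  have hmem1 : (1 : ℝ) ∈ interior (Ici (0 : ℝ)) := by simp
  have hDm := (hγc.hasDerivWithinAt_leftDeriv_of_mem_interior hmem1).Iic_of_Iio
  have hDp := (hγc.hasDerivWithinAt_rightDeriv_of_mem_interior hmem1).Ici_of_Ioi
  have hmp := hγc.leftDeriv_le_rightDeriv_of_mem_interior hmem1
  have hP01 : P 0 1 = 1 := by
    refine tendsto_nhds_unique (hP 0 1 zero_le_one) ?_
    have : ∀ k : ℕ, PsiSV B p τ1 τ2 k 0 1 = 1 := by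
      intro k
      rw [Psi_eq B hc0 hd0 p hp0]
      have h0 : ∀ l, tauW B τ1 τ2 l 1 = 0 := fun l => by unfold tauW; split_ifs <;> assumption
      simp only [h0, sub_self, zero_mul, add_zero, Real.exp_zero, Ew_const p hpsum]
    simp only [this, Real.one_rpow]
    exact tendsto_const_nhds
  have hγ1 : γ 1 = 0 := by
    apply le_antisymm
    · have := gamma_le ha hPm (b := 0) zero_le_one le_rfl (hγ 1 zero_le_one) (s := 0)
        (by simp [hP01])
      simpa using this
    · have := gamma_le ha hPm (b := 0) zero_le_one le_rfl hP01 (s := γ 1)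
        (by simp [hγ 1 zero_le_one])
      simpa using this
  set N : ℕ → ℝ := fun k => Ew p k (fun l => Real.log (wordProb p l) +
    (if B.usesPi1 l then D1 else D2) * lr B l) with hN
  set M : ℕ → ℝ := fun k => Ew p k (lm B) with hM
  have hT : ∀ k g, Ew p k (th B p D1 D2 g) = N k + g * M k := fun k g =>
    Ew_add_mul p k (fun l => Real.log (wordProb p l) +
      (if B.usesPi1 l then D1 else D2) * lr B l) (lm B) g
  have hMk : ∀ k : ℕ, M k ≤ -(a * k) := by
    intro k
    rw [← Ew_const p hpsum k (-(a * k))]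
    refine Ew_mono p hp0 k fun l hl => ?_
    rw [← hl]
    exact (hb l).1
  have hMneg : ∀ k : ℕ, 1 ≤ k → M k < 0 := fun k hk => by
    have h1 := hMk k
    have h2 : (0 : ℝ) < k := by exact_mod_cast hk
    have := mul_pos ha h2
    linarith
  set G : ℕ → ℝ := fun k => -N k / M k with hG
  have hGz : ∀ k, 1 ≤ k → N k + G k * M k = 0 := fun k hk => by
    have := (hMneg k hk).ne
    simp only [hG]
    field_simp
    ring
  have hGd : ∀ k, 1 ≤ k → HasDerivAt (γks k) (G k) 1 := by
    intro k hk
    have hk0 : (0 : ℝ) < k := by exact_mod_cast hk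
    refine (implicit_deriv (A := Fin k → ι) (fun f => wordProb p (List.ofFn f))
      (fun f => Real.log (wordProb p (List.ofFn f)) +
        (if B.usesPi1 (List.ofFn f) then D1 else D2) * lr B (List.ofFn f))
      (fun f => lm B (List.ofFn f))
      (fun f q => (q - 1) * Real.log (wordProb p (List.ofFn f)) +
        tauW B τ1 τ2 (List.ofFn f) q * lr B (List.ofFn f)) (γks k)
      (fun f => wordProb_pos p hp0 _) (Ew_one p hpsum k) ?_ ?_ ?_ ?_).2
    · intro f
      have h1 := (hb (List.ofFn f)).1
      rw [List.length_ofFn] at h1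
      have := mul_pos ha hk0
      linarith
    · intro f
      have h0 : tauW B τ1 τ2 (List.ofFn f) 1 = 0 := by unfold tauW; split_ifs <;> assumption
      simp [h0]
    · intro f
      have h1 : HasDerivAt (fun q : ℝ => (q - 1) * Real.log (wordProb p (List.ofFn f)))
          (1 * Real.log (wordProb p (List.ofFn f))) 1 :=
        ((hasDerivAt_id (1 : ℝ)).sub_const 1).mul_const _
      rw [one_mul] at h1
      refine h1.add ?_
      refine HasDerivAt.mul_const ?_ _
      unfold tauW
      split_ifs <;> assumption
    · filter_upwards [lt_mem_nhds (show (0 : ℝ) < 1 from one_pos)] with q hq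
      have := hγks k hk q hq.le
      rw [Psi_eq B hc0 hd0 p hp0] at this
      exact this
  have hg1G : g1 = G 1 := hg1.unique (hGd 1 le_rfl)
  -- additivity at the critical value
  have hadd : ∀ k, 1 ≤ k → N k + (D1 + D2) * M k = k * (N 1 + (D1 + D2) * M 1) := by
    intro k hk
    induction k, hk using Nat.le_induction with
    | base => simp
    | succ k hk ih =>
      have h1 := Ew_sub p hp0 hpsum (th_sub B hc0 hd0 p hp0 hD (le_refl (D1 + D2))) k 1
      have h2 := Ew_sub p hp0 hpsum (F := fun l => - th B p D1 D2 (D1 + D2) l)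
        (fun l m => by
          have := th_super B hc0 hd0 p hp0 hD (le_refl (D1 + D2)) l m
          linarith) k 1
      rw [Ew_neg, Ew_neg, Ew_neg] at h2
      rw [hT, hT, hT] at h1 h2
      push_cast
      linarith
  refine ⟨_, _, hDm, hDp, fun hle => ?_, fun hle => ?_⟩
  · rw [hg1G] at hle
    have hGle : ∀ k, 1 ≤ k → G k ≤ D1 + D2 := by
      intro k hk
      have h1 : N 1 + (D1 + D2) * M 1 ≤ 0 := by
        have := hGz 1 le_rfl
        nlinarith [hMneg 1 le_rfl]
      have h2 : N k + (D1 + D2) * M k ≤ 0 := by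
        rw [hadd k hk]
        exact mul_nonpos_of_nonneg_of_nonpos (Nat.cast_nonneg k) h1
      by_contra hcon
      have := hGz k hk
      nlinarith [hMneg k hk]
    refine ⟨G, hGd, ?_⟩
    obtain ⟨L, h1, h2, h3⟩ := fekete_zeros N M ha (fun k _ => hMk k) (gs := D1 + D2)
      (fun g hg k m => by
        have := Ew_sub p hp0 hpsum (th_sub B hc0 hd0 p hp0 hD hg) k m
        rwa [hT, hT, hT] at this) hGle
      (D := derivWithin γ (Ioi 1) 1) (fun k hk => by
        obtain ⟨H, hH, hHle⟩ := upper B hc0 hd0 p hp0 hpsum τ1 τ2 ha hC (fun l => (hb l).2)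
          P hP (fun s q h hq hh => hPm s q h hq hh) γ hγ hD1 hD2 h10 h20 hk
          (g := G k) (by rw [hT]; exact hGz k hk)
        refine right_deriv_le hDp hγ1 hH fun q hq => hHle q (by linarith) fun l m => ?_
        have := mul_le_mul_of_nonneg_left (th_sub B hc0 hd0 p hp0 hD (hGle k hk) l m)
          (sub_nonneg.2 hq)
        linarith)
    exact ⟨L, h1, h2, h3, hmp⟩
  · rw [hg1G] at hle
    have hGle : ∀ k, 1 ≤ k → D1 + D2 ≤ G k := by
      intro k hk
      have h1 : 0 ≤ N 1 + (D1 + D2) * M 1 := by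
        have := hGz 1 le_rfl
        nlinarith [hMneg 1 le_rfl]
      have h2 : 0 ≤ N k + (D1 + D2) * M k := by
        rw [hadd k hk]
        exact mul_nonneg (Nat.cast_nonneg k) h1
      by_contra hcon
      have := hGz k hk
      nlinarith [hMneg k hk]
    refine ⟨G, hGd, ?_⟩
    have hneg : ∀ k, -(-N k) / M k = - G k := fun k => by
      simp only [hG]
      ring
    obtain ⟨L, h1, h2, h3⟩ := fekete_zeros (fun k => -N k) M ha (fun k _ => hMk k)
      (gs := -(D1 + D2))
      (fun g hg k m => by
        have := Ew_sub p hp0 hpsum (F := fun l => - th B p D1 D2 (-g) l)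
          (fun l m => by
            have := th_super B hc0 hd0 p hp0 hD (g := -g) (by linarith) l m
            linarith) k m
        rw [Ew_neg, Ew_neg, Ew_neg, hT, hT, hT] at this
        linarith) (fun k hk => by
          have := hGle k hk
          rw [hneg]
          linarith)
      (D := -derivWithin γ (Iio 1) 1) (fun k hk => by
        rw [hneg]
        refine neg_le_neg ?_
        obtain ⟨H, hH, hHle⟩ := upper B hc0 hd0 p hp0 hpsum τ1 τ2 ha hC (fun l => (hb l).2)
          P hP (fun s q h hq hh => hPm s q h hq hh) γ hγ hD1 hD2 h10 h20 hk
          (g := G k) (by rw [hT]; exact hGz k hk)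
        refine le_left_deriv hDm hγ1 hH fun q hq0 hq => hHle q hq0 fun l m => ?_
        have := mul_le_mul_of_nonneg_left (th_super B hc0 hd0 p hp0 hD (hGle k hk) l m)
          (sub_nonneg.2 hq)
        linarith)
    simp only [hneg] at h1 h2
    refine ⟨-L, by simpa using h1.neg, fun k hk => ?_, by linarith, hmp⟩
    have := h2 k hk
    linarith
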